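/- arXiv:2502.07100 — 4 statements merged into one kernel-verified Lean document; each statement's English description precedes it below -/
import Mathlib

section
/- Fix integers n ≥ m ≥ r ≥ 1 with n, m ≥ 2, and for each positive integer k let A_k = {2^s : 1 ≤ s ≤ 2k} ⊆ ℚ^*, a finite subset of the rank-one multiplicative group generated by 2, with #A_k = 2k. Then there exist c > 0 and k₀ such that for all k ≥ k₀ one has #R_{m,n}(A_k; r) ≥ c·k^{nr + m − r}. In particular, the bound #R_{m,n}(A; r) = O(A^{nr+m−r}) in the range 2m ≤ n + r is tight. -/
/-- Exponents of an `r × n` matrix whose diagonal entries lie in `(2q, 3q]` and whose other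
entries lie in `[1, q]`. -/
def topExponent {r n q : ℕ} (f : Fin r × Fin n → Fin q) (i : Fin r) (j : Fin n) : ℕ :=
  (f (i, j)).val + 1 + if i.val = j.val then 2 * q else 0

/-- Exponents of an `(r + 1 + d) × n` matrix: the top rows come from `topExponent`, and each
remaining row is a shift of the first one. -/
def rankExponent {r d n q : ℕ} (f : Fin (r + 1) × Fin n → Fin q) (g : Fin d → Fin q)
    (i : Fin (r + 1 + d)) (j : Fin n) : ℕ :=
  Fin.addCases (motive := fun _ => ℕ) (fun i => topExponent f i j)
    (fun i => (g i).val + topExponent f 0 j) i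

@[simp] lemma rankExponent_castAdd {r d n q : ℕ} (f : Fin (r + 1) × Fin n → Fin q)
    (g : Fin d → Fin q) (i : Fin (r + 1)) (j : Fin n) :
    rankExponent f g (Fin.castAdd d i) j = topExponent f i j := by
  simp [rankExponent]

@[simp] lemma rankExponent_natAdd {r d n q : ℕ} (f : Fin (r + 1) × Fin n → Fin q)
    (g : Fin d → Fin q) (i : Fin d) (j : Fin n) :
    rankExponent f g (Fin.natAdd (r + 1) i) j = (g i).val + topExponent f 0 j := by
  simp [rankExponent]

lemma topExponent_mem {r n q : ℕ} (f : Fin r × Fin n → Fin q) (i : Fin r) (j : Fin n) :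
    1 ≤ topExponent f i j ∧ topExponent f i j ≤ 3 * q := by
  have := (f (i, j)).isLt
  unfold topExponent
  split_ifs <;> omega

lemma rankExponent_mem {r d n q : ℕ} (f : Fin (r + 1) × Fin n → Fin q) (g : Fin d → Fin q)
    (i : Fin (r + 1 + d)) (j : Fin n) :
    1 ≤ rankExponent f g i j ∧ rankExponent f g i j ≤ 4 * q := by
  induction i using Fin.addCases with
  | left i =>
    have := topExponent_mem f i j
    rw [rankExponent_castAdd]
    omega
  | right i =>
    have := topExponent_mem f 0 j
    have := (g i).isLt
    rw [rankExponent_natAdd]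
    omega

lemma rankExponent_injective {r d n q : ℕ} (hn : 0 < n) :
    Function.Injective (fun p : (Fin (r + 1) × Fin n → Fin q) × (Fin d → Fin q) =>
      rankExponent p.1 p.2) := by
  rintro ⟨f, g⟩ ⟨f', g'⟩ h
  have htop (i : Fin (r + 1)) (j : Fin n) : topExponent f i j = topExponent f' i j := by
    simpa using congrFun (congrFun h (Fin.castAdd d i)) j
  refine Prod.ext (funext fun ⟨i, j⟩ => Fin.ext ?_) (funext fun i => Fin.ext ?_)
  · simpa [topExponent] using htop i j
  · simpa [htop] using congrFun (congrFun h (Fin.natAdd (r + 1) i)) ⟨0, hn⟩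

lemma det_topExponent_ne_zero {r e q : ℕ} (hq : r ≤ q) (f : Fin r × Fin (r + e) → Fin q) :
    (Matrix.of fun i j : Fin r => (2 : ℚ) ^ topExponent f i (Fin.castAdd e j)).det ≠ 0 := by
  refine det_ne_zero_of_sum_row_lt_diag fun i => ?_
  have hnorm (a : ℕ) : ‖(2 : ℚ) ^ a‖ = (2 : ℝ) ^ a := by
    rw [norm_pow, show ‖(2 : ℚ)‖ = 2 by rw [← Rat.norm_cast_real]; norm_num]
  simp only [Matrix.of_apply, hnorm]
  calc ∑ j ∈ Finset.univ.erase i, (2 : ℝ) ^ topExponent f i (Fin.castAdd e j)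
      ≤ ∑ j ∈ Finset.univ.erase i, (2 : ℝ) ^ q := by
        refine Finset.sum_le_sum fun j hj => pow_le_pow_right₀ one_le_two ?_
        have hij : i.val ≠ j.val := fun h => Finset.ne_of_mem_erase hj (Fin.ext h.symm)
        have := (f (i, Fin.castAdd e j)).isLt
        simp only [topExponent, Fin.val_castAdd, if_neg hij]
        omega
    _ ≤ (2 : ℝ) ^ q * 2 ^ q := by
        rw [Finset.sum_const, nsmul_eq_mul]
        gcongr
        have hcard : (Finset.univ.erase i).card ≤ 2 ^ q :=
          (Finset.card_le_univ _).trans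
            ((Fintype.card_fin r).trans_le (hq.trans Nat.lt_two_pow_self.le))
        exact_mod_cast hcard
    _ < (2 : ℝ) ^ topExponent f i (Fin.castAdd e i) := by
        rw [← pow_add]
        refine pow_lt_pow_right₀ one_lt_two ?_
        simp only [topExponent, Fin.val_castAdd, if_true]
        omega

lemma rank_rankExponent {r d e q : ℕ} (hq : r + 1 ≤ q)
    (f : Fin (r + 1) × Fin (r + 1 + e) → Fin q) (g : Fin d → Fin q) :
    (Matrix.of fun i j => (2 : ℚ) ^ rankExponent f g i j).rank = r + 1 := by
  set X := Matrix.of fun i j => (2 : ℚ) ^ rankExponent f g i j with hX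
  apply le_antisymm
  · let B : Matrix (Fin (r + 1)) (Fin (r + 1 + e)) ℚ := X.submatrix (Fin.castAdd d) id
    rw [Matrix.rank_eq_finrank_span_row]
    have hspan : Submodule.span ℚ (Set.range X.row) ≤ Submodule.span ℚ (Set.range B.row) := by
      rw [Submodule.span_le]
      rintro _ ⟨i, rfl⟩
      induction i using Fin.addCases with
      | left i => exact Submodule.subset_span ⟨i, rfl⟩
      | right i =>
        have hrow : X.row (Fin.natAdd (r + 1) i) = (2 : ℚ) ^ (g i).val • B.row 0 := by
          ext j
          simp [B, hX, Matrix.row, pow_add, -Fin.castAdd_zero]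
        rw [hrow]
        exact Submodule.smul_mem _ _ (Submodule.subset_span ⟨0, rfl⟩)
    exact (Submodule.finrank_mono hspan).trans
      ((finrank_range_le_card B.row).trans_eq (Fintype.card_fin _))
  · have hdet := det_topExponent_ne_zero hq f
    have hsub : X.submatrix (Fin.castAdd d) (Fin.castAdd e) =
        Matrix.of fun i j : Fin (r + 1) => (2 : ℚ) ^ topExponent f i (Fin.castAdd e j) := by
      ext i j
      simp [hX]
    have hrank := Matrix.rank_of_isUnit _ ((Matrix.isUnit_iff_isUnit_det _).2 hdet.isUnit)
    rw [Fintype.card_fin, ← hsub] at hrank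
    exact hrank.ge.trans (Matrix.rank_submatrix_le _ _ _)

theorem count_matrices_of_rank_lower_bound (m n r : ℕ) (hm : 2 ≤ m) (hn : 2 ≤ n)
    (hmn : m ≤ n) (hrm : r ≤ m) (hr : 1 ≤ r) :
    ∃ c : ℝ, 0 < c ∧ ∃ k₀ : ℕ, ∀ k ≥ k₀,
      c * (k : ℝ) ^ (n * r + m - r) ≤
        ({X : Matrix (Fin m) (Fin n) ℚ |
            (∀ i j, X i j ∈ (Finset.Icc 1 (2 * k)).image (fun s : ℕ => (2 : ℚ) ^ s)) ∧
            X.rank = r}.ncard : ℝ) := by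
  obtain ⟨s, rfl⟩ : ∃ s, r = s + 1 := ⟨r - 1, by omega⟩
  obtain ⟨d, rfl⟩ := Nat.exists_eq_add_of_le hrm
  obtain ⟨e, rfl⟩ := Nat.exists_eq_add_of_le (hrm.trans hmn)
  refine ⟨(1 / 4) ^ ((s + 1 + e) * (s + 1) + (s + 1 + d) - (s + 1)), by positivity,
    2 * (s + 1), fun k hk => ?_⟩
  obtain ⟨q, hq⟩ : ∃ q, q = k / 2 := ⟨_, rfl⟩
  let F (p : (Fin (s + 1) × Fin (s + 1 + e) → Fin q) × (Fin d → Fin q)) :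
      Matrix (Fin (s + 1 + d)) (Fin (s + 1 + e)) ℚ :=
    Matrix.of fun i j => (2 : ℚ) ^ rankExponent p.1 p.2 i j
  have hF : Function.Injective F := fun p p' h => rankExponent_injective (by omega) <| by
    ext i j
    exact pow_right_injective₀ (two_pos : (0 : ℚ) < 2) (by norm_num) (congrFun (congrFun h i) j)
  have hcard : (Set.range F).ncard = q ^ ((s + 1 + e) * (s + 1) + (s + 1 + d) - (s + 1)) := by
    rw [← Set.image_univ, Set.ncard_image_of_injective _ hF, Set.ncard_univ,
      Nat.card_eq_fintype_card, show (s + 1 + e) * (s + 1) + (s + 1 + d) - (s + 1)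
        = (s + 1) * (s + 1 + e) + d by rw [mul_comm]; omega]
    simp [pow_add]
  have hfin : {X : Matrix (Fin (s + 1 + d)) (Fin (s + 1 + e)) ℚ |
      (∀ i j, X i j ∈ (Finset.Icc 1 (2 * k)).image (fun s : ℕ => (2 : ℚ) ^ s)) ∧
      X.rank = s + 1}.Finite :=
    (Set.Finite.pi' fun _ => Set.Finite.pi' fun _ => Finset.finite_toSet _).subset
      fun X hX => hX.1
  have hle := Set.ncard_le_ncard (s := Set.range F) (by
    rintro _ ⟨⟨f, g⟩, rfl⟩
    refine ⟨fun i j => Finset.mem_image.2 ⟨rankExponent f g i j, ?_, rfl⟩,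
      rank_rankExponent (by omega) f g⟩
    have := rankExponent_mem f g i j
    rw [Finset.mem_Icc]
    omega) hfin
  rw [hcard] at hle
  refine le_trans ?_ (Nat.cast_le.2 hle)
  rw [← mul_pow, Nat.cast_pow]
  have hkq : (k : ℝ) ≤ 4 * q := by exact_mod_cast (by omega : k ≤ 4 * q)
  gcongr
  linarith
end

section
/- Fix an integer n ≥ 2, and for each positive integer k let A_k = {2^s : 1 ≤ s ≤ 2k} ⊆ ℚ^*, a finite subset of the rank-one multiplicative group generated by 2, with #A_k = 2k. Then there exist c > 0 and k₀ such that for all k ≥ k₀ one has #D_n(A_k; 0) ≥ c·k^{n² − n + 1}. -/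
/-- A matrix with two proportional rows is singular. -/
theorem Matrix.det_eq_zero_of_row_eq_smul_row {m R : Type*} [Fintype m] [DecidableEq m]
    [CommRing R] [IsDomain R] (M : Matrix m m R) {p q : m} (hpq : p ≠ q) (c : R)
    (h : M q = c • M p) : M.det = 0 := by
  rw [← Matrix.exists_vecMul_eq_zero_iff]
  refine ⟨Pi.single q 1 - c • Pi.single p 1, fun h0 => ?_, ?_⟩
  · have h1 := congrFun h0 q
    simp [hpq.symm] at h1
  · ext j
    simp [Matrix.sub_vecMul, Matrix.smul_vecMul, h]

/-- The matrix of powers of two with freely chosen exponents outside row `q`, whose row `q` is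
`2 ^ t` times row `p`. -/
def proportionalRowsMatrix {n k : ℕ} {p q : Fin n} (hpq : p ≠ q)
    (x : ({i : Fin n // i ≠ q} → Fin n → Fin k) × Fin k) : Matrix (Fin n) (Fin n) ℚ :=
  fun i j => 2 ^ (if h : i = q then (x.1 ⟨p, hpq⟩ j : ℕ) + 1 + x.2 else (x.1 ⟨i, h⟩ j : ℕ) + 1)

theorem proportionalRowsMatrix_injective {n k : ℕ} {p q : Fin n} (hpq : p ≠ q) :
    Function.Injective (proportionalRowsMatrix (k := k) hpq) := by
  intro x y hxy
  have key : ∀ i j, _ = _ := fun i j =>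
    pow_right_injective₀ (by norm_num : (0 : ℚ) < 2) (by norm_num) (congrFun (congrFun hxy i) j)
  have h1 : x.1 = y.1 := by
    ext ⟨i, hi⟩ j
    simpa [hi] using key i j
  refine Prod.ext h1 (Fin.ext ?_)
  simpa [h1] using key q q

theorem det_proportionalRowsMatrix {n k : ℕ} {p q : Fin n} (hpq : p ≠ q)
    (x : ({i : Fin n // i ≠ q} → Fin n → Fin k) × Fin k) :
    (proportionalRowsMatrix hpq x).det = 0 := by
  refine Matrix.det_eq_zero_of_row_eq_smul_row _ hpq (2 ^ (x.2 : ℕ)) ?_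
  ext j
  simp [proportionalRowsMatrix, hpq, pow_add, mul_comm]

theorem proportionalRowsMatrix_mem {n k : ℕ} {p q : Fin n} (hpq : p ≠ q)
    (x : ({i : Fin n // i ≠ q} → Fin n → Fin k) × Fin k) (i j : Fin n) :
    proportionalRowsMatrix hpq x i j ∈
      (Finset.Icc 1 (2 * k)).image (fun s : ℕ => (2 : ℚ) ^ s) := by
  refine Finset.mem_image_of_mem _ (Finset.mem_Icc.2 ?_)
  split_ifs <;> omega

theorem count_singular_matrices_lower_bound (n : ℕ) (hn : 2 ≤ n) :
    ∃ c : ℝ, 0 < c ∧ ∃ k₀ : ℕ, ∀ k ≥ k₀,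
      c * (k : ℝ) ^ (n ^ 2 - n + 1) ≤
        ({X : Matrix (Fin n) (Fin n) ℚ |
            (∀ i j, X i j ∈ (Finset.Icc 1 (2 * k)).image (fun s : ℕ => (2 : ℚ) ^ s)) ∧
            X.det = 0}.ncard : ℝ) := by
  refine ⟨1, one_pos, 0, fun k _ => ?_⟩
  have hpq : (⟨0, by omega⟩ : Fin n) ≠ ⟨1, by omega⟩ := by simp
  have hfin : {X : Matrix (Fin n) (Fin n) ℚ |
      (∀ i j, X i j ∈ (Finset.Icc 1 (2 * k)).image (fun s : ℕ => (2 : ℚ) ^ s)) ∧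
      X.det = 0}.Finite := by
    refine (Set.Finite.pi' fun _ : Fin n => Set.Finite.pi' fun _ : Fin n =>
      Finset.finite_toSet ((Finset.Icc 1 (2 * k)).image (fun s : ℕ => (2 : ℚ) ^ s))).subset ?_
    exact fun X hX => hX.1
  have hsub : Set.range (proportionalRowsMatrix (k := k) hpq) ⊆ {X : Matrix (Fin n) (Fin n) ℚ |
      (∀ i j, X i j ∈ (Finset.Icc 1 (2 * k)).image (fun s : ℕ => (2 : ℚ) ^ s)) ∧
      X.det = 0} := Set.range_subset_iff.2 fun x =>
    ⟨proportionalRowsMatrix_mem hpq x, det_proportionalRowsMatrix hpq x⟩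
  have hle := Set.ncard_le_ncard hsub hfin
  have hcard : (Set.range (proportionalRowsMatrix (k := k) hpq)).ncard = k ^ (n ^ 2 - n + 1) := by
    rw [← Set.image_univ, Set.ncard_image_of_injective _ (proportionalRowsMatrix_injective hpq),
      Set.ncard_univ, Nat.card_eq_fintype_card]
    have hexp : n * (n - 1) = n ^ 2 - n := by rw [Nat.mul_sub, mul_one, sq]
    simp [Fintype.card_subtype_compl, ← pow_mul, hexp, pow_succ]
  rw [one_mul]
  exact_mod_cast hcard ▸ hle
end

section
/- For each positive integer k let A_k = {2^s : 0 ≤ s < k} ∪ {−2^s : 0 ≤ s < k} ⊆ ℚ^*, a finite subset of the finite rank multiplicative group generated by −1 and 2. Then there exist c > 0 and k₀ such that for all k ≥ k₀ one has #P_2(A_k; T²) ≥ c·k²; that is, the number of 2×2 matrices over A_k with characteristic polynomial T² (equivalently, with zero trace and zero determinant) is at least c·(#A_k)². In particular, for the characteristic polynomial T² (the case d = t = 0) the trivial bound O(A²) is tight. -/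
theorem Matrix.finite_setOf_forall_mem {m n α : Type*} [Finite m] [Finite n] (A : Finset α) :
    {X : Matrix m n α | ∀ i j, X i j ∈ A}.Finite :=
  Set.Finite.pi' fun _ : m => Set.Finite.pi' fun _ : n => A.finite_toSet

theorem Matrix.charpoly_fin_two_eq_X_sq {R : Type*} [CommRing R] [Nontrivial R]
    {X : Matrix (Fin 2) (Fin 2) R} (htr : X.trace = 0) (hdet : X.det = 0) :
    X.charpoly = Polynomial.X ^ 2 := by
  simp [Matrix.charpoly_fin_two, htr, hdet]

/-- A family of nilpotent matrices with entries `± 2 ^ s`. -/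
def nilpotentOfExponents (p : ℕ × ℕ) : Matrix (Fin 2) (Fin 2) ℚ :=
  !![2 ^ (p.1 + p.2), 2 ^ (2 * p.1); -2 ^ (2 * p.2), -2 ^ (p.1 + p.2)]

theorem charpoly_nilpotentOfExponents (p : ℕ × ℕ) :
    (nilpotentOfExponents p).charpoly = Polynomial.X ^ 2 := by
  apply Matrix.charpoly_fin_two_eq_X_sq
  · simp [nilpotentOfExponents, Matrix.trace_fin_two]
  · simp only [nilpotentOfExponents, Matrix.det_fin_two_of]
    ring

theorem nilpotentOfExponents_injective : Function.Injective nilpotentOfExponents := by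
  rintro ⟨a, b⟩ ⟨c, d⟩ h
  have h₁ := congrFun (congrFun h 0) 1
  have h₂ := congrFun (congrFun h 1) 0
  have hpow : Function.Injective fun n : ℕ => (2 : ℚ) ^ n :=
    pow_right_injective₀ (by norm_num) (by norm_num)
  simp only [nilpotentOfExponents, Matrix.of_apply, Matrix.cons_val', Matrix.cons_val_zero,
    Matrix.cons_val_one, Matrix.cons_val_fin_one, neg_inj] at h₁ h₂
  have h₃ := hpow h₁
  have h₄ := hpow h₂
  ext <;> dsimp only <;> omega

theorem count_two_by_two_nilpotent_lower_bound :
    ∃ c : ℝ, 0 < c ∧ ∃ k₀ : ℕ, ∀ k ≥ k₀,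
      c * (k : ℝ) ^ 2 ≤
        ({X : Matrix (Fin 2) (Fin 2) ℚ |
            (∀ i j, X i j ∈
              (Finset.range k).image (fun s : ℕ => (2 : ℚ) ^ s) ∪
              (Finset.range k).image (fun s : ℕ => -(2 : ℚ) ^ s)) ∧
            X.charpoly = Polynomial.X ^ 2}.ncard : ℝ) := by
  refine ⟨1 / 4, by norm_num, 0, fun k _ => ?_⟩
  set S := {X : Matrix (Fin 2) (Fin 2) ℚ |
    (∀ i j, X i j ∈
      (Finset.range k).image (fun s : ℕ => (2 : ℚ) ^ s) ∪
      (Finset.range k).image (fun s : ℕ => -(2 : ℚ) ^ s)) ∧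
    X.charpoly = Polynomial.X ^ 2}
  have hfin : S.Finite := (Matrix.finite_setOf_forall_mem _).subset fun X hX => hX.1
  set m := (k + 1) / 2 with hm
  have hsub : nilpotentOfExponents '' (Finset.range m ×ˢ Finset.range m : Finset (ℕ × ℕ)) ⊆ S := by
    rintro _ ⟨⟨a, b⟩, hab, rfl⟩
    simp only [Finset.coe_product, Set.mem_prod, Finset.mem_coe, Finset.mem_range] at hab
    refine ⟨fun i j => ?_, charpoly_nilpotentOfExponents _⟩
    simp only [Finset.mem_union, Finset.mem_image, Finset.mem_range]
    fin_cases i <;> fin_cases j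
    · exact .inl ⟨a + b, by omega, rfl⟩
    · exact .inl ⟨2 * a, by omega, rfl⟩
    · exact .inr ⟨2 * b, by omega, rfl⟩
    · exact .inr ⟨a + b, by omega, rfl⟩
  have hcard : m * m ≤ S.ncard := by
    have h := Set.ncard_le_ncard hsub hfin
    rwa [Set.ncard_image_of_injective _ nilpotentOfExponents_injective, Set.ncard_coe_finset,
      Finset.card_product, Finset.card_range] at h
  have hcard' : (m : ℝ) * m ≤ S.ncard := by exact_mod_cast hcard
  have hk : (k : ℝ) ≤ 2 * m := by
    have : k ≤ 2 * m := by omega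
    exact_mod_cast this
  have hk0 : (0 : ℝ) ≤ k := k.cast_nonneg
  nlinarith
end

section
/- Let K be a field of characteristic zero and Γ a subgroup of K^* of finite rank, and let n ≥ 3 be an integer. Define α(n) = n(n−1)/2 + max{ ⌊(n−1)/2⌋ + ⌊n(n−1)/4⌋ , ⌊n/2⌋ + ⌊(n(n−1) − 2)/4⌋ }. Then there exists a constant C > 0, depending only on n and the rank of Γ, such that for every monic polynomial f ∈ K[T] of degree n and every finite subset A of Γ of cardinality A = #A, one has #P_n(A; f) ≤ C·A^{α(n)}. -/
/-- A subgroup `Γ` of a (commutative) group has finite rank `ρ` if there is a finitely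
generated subgroup `Γ₀ ≤ Γ`, generated by `ρ` elements, such that every `x ∈ Γ` has a
positive power lying in `Γ₀`. -/
def FinRank {G : Type*} [CommGroup G] (Γ : Subgroup G) (ρ : ℕ) : Prop :=
  ∃ S : Finset G, S.card = ρ ∧ (S : Set G) ⊆ (Γ : Set G) ∧
    ∀ x ∈ Γ, ∃ k : ℕ, 0 < k ∧ x ^ k ∈ Subgroup.closure (S : Set G)

/-- The exponent `α(n) = n(n-1)/2 + max{⌊(n-1)/2⌋ + ⌊n(n-1)/4⌋, ⌊n/2⌋ + ⌊(n(n-1)-2)/4⌋}`. -/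
def alphaExp (n : ℕ) : ℕ :=
  n * (n - 1) / 2 + max ((n - 1) / 2 + n * (n - 1) / 4) (n / 2 + (n * (n - 1) - 2) / 4)

section GroupAlgebra

open AddMonoidAlgebra

variable {G : Type*} [AddCommGroup G]

/-- The involution `x ↦ -x` on the real group algebra of an additive commutative group. -/
noncomputable def gaStar (G : Type*) [AddCommGroup G] :
    AddMonoidAlgebra ℝ G →+* AddMonoidAlgebra ℝ G :=
  mapDomainRingHom ℝ (-AddMonoidHom.id G)

lemma gaStar_single (x : G) (r : ℝ) : gaStar G (single x r) = single (-x) r := by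
  simp [gaStar, mapDomain_single]

lemma gaStar_gaStar (f : AddMonoidAlgebra ℝ G) : gaStar G (gaStar G f) = f := by
  induction f using AddMonoidAlgebra.induction_linear with
  | zero => simp
  | add f g hf hg => simp [hf, hg]
  | single m r => simp [gaStar_single]

/-- The pairing `⟨f, g⟩ = (f * g*)(0)` on the group algebra. -/
noncomputable def gaForm (G : Type*) [AddCommGroup G] :
    LinearMap.BilinForm ℝ (AddMonoidAlgebra ℝ G) :=
  LinearMap.mk₂ ℝ (fun f g => (f * gaStar G g).coeff 0)
    (by intro f f' g; simp [add_mul])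
    (by intro c f g; simp)
    (by intro f g g'; simp [mul_add])
    (by
      intro c f g
      have : gaStar G (c • g) = c • gaStar G g := by
        rw [← mul_one (c • g), smul_mul_assoc, ← mul_smul_comm, map_mul, one_def, smul_single,
          gaStar_single, ← mul_one (c • gaStar G g), smul_mul_assoc, ← mul_smul_comm, one_def,
          smul_single, neg_zero]
      simp [this])

lemma gaForm_apply (f g : AddMonoidAlgebra ℝ G) :
    gaForm G f g = (f * gaStar G g).coeff 0 := rfl

lemma gaForm_eq_sum (f g : AddMonoidAlgebra ℝ G) :
    gaForm G f g = g.coeff.sum fun x r => f.coeff x * r := by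
  classical
  induction g using AddMonoidAlgebra.induction_linear with
  | zero => simp
  | add g g' hg hg' =>
    rw [map_add, hg, hg', coeff_add, Finsupp.sum_add_index']
    · simp
    · intros; ring
  | single m r =>
    rw [gaForm_apply, gaStar_single, coeff_single, Finsupp.sum_single_index (by simp),
      coeff_mul_single_eq_coeff_mul m]
    intro a _
    rw [add_neg_eq_zero]

lemma gaForm_self_nonneg (f : AddMonoidAlgebra ℝ G) : 0 ≤ gaForm G f f := by
  rw [gaForm_eq_sum]
  exact Finset.sum_nonneg fun x _ => mul_self_nonneg _

lemma gaForm_comm (f g : AddMonoidAlgebra ℝ G) : gaForm G f g = gaForm G g f := by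
  have key : ∀ h : AddMonoidAlgebra ℝ G, (gaStar G h).coeff 0 = h.coeff 0 := by
    intro h
    have h1 := gaForm_eq_sum 1 h
    have h2 := gaForm_eq_sum (G := G) h 1
    rw [gaForm_apply] at h1 h2
    rw [one_mul] at h1
    rw [map_one, mul_one] at h2
    classical
    rw [h1, one_def, coeff_single]
    simp only [Finsupp.single_apply]
    rw [Finsupp.sum]
    simp +contextual
  rw [gaForm_apply, gaForm_apply, ← key (f * gaStar G g), map_mul, gaStar_gaStar, mul_comm]

/-- The even moment `((f * f*) ^ (2 ^ s))(0)` of an element of the group algebra. -/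
noncomputable def moment (s : ℕ) (f : AddMonoidAlgebra ℝ G) : ℝ :=
  ((f * gaStar G f) ^ 2 ^ s).coeff 0

lemma moment_mul_gaStar (s : ℕ) (f : AddMonoidAlgebra ℝ G) :
    moment s (f * gaStar G f) = moment (s + 1) f := by
  rw [moment, moment, map_mul, gaStar_gaStar, mul_comm (gaStar G f) f, ← sq, ← pow_mul,
    pow_succ' 2 s]

lemma moment_gaStar (s : ℕ) (f : AddMonoidAlgebra ℝ G) :
    moment s (gaStar G f) = moment s f := by
  rw [moment, moment, gaStar_gaStar, mul_comm]

lemma moment_one (s : ℕ) : moment s (1 : AddMonoidAlgebra ℝ G) = 1 := by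
  simp only [moment, map_one, mul_one, one_pow]
  simp [one_def]

lemma moment_nonneg (s : ℕ) (f : AddMonoidAlgebra ℝ G) : 0 ≤ moment s f := by
  induction s generalizing f with
  | zero => simpa [moment, gaForm_apply] using gaForm_self_nonneg f
  | succ s ih => rw [← moment_mul_gaStar]; exact ih _

lemma sq_coeff_mul_le (f g : AddMonoidAlgebra ℝ G) :
    ((f * g).coeff 0) ^ 2 ≤ (f * gaStar G f).coeff 0 * (g * gaStar G g).coeff 0 := by
  have h := LinearMap.BilinForm.apply_mul_apply_le_of_forall_zero_le (gaForm G)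
    gaForm_self_nonneg f (gaStar G g)
  rw [gaForm_comm (gaStar G g) f, ← sq] at h
  simpa [gaForm_apply, gaStar_gaStar, mul_comm (gaStar G g) g] using h

/-- Hölder's inequality for the even moments, in multiplicative form. -/
lemma pow_coeff_prod_le {ι : Type*} (s : ℕ) (T : Finset ι) (hT : T.card = 2 ^ (s + 1))
    (f : ι → AddMonoidAlgebra ℝ G) (u : AddMonoidAlgebra ℝ G) (hu : u * gaStar G u = 1) :
    ((u * ∏ i ∈ T, f i).coeff 0) ^ 2 ^ (s + 1) ≤ ∏ i ∈ T, moment s (f i) := by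
  classical
  induction s generalizing T f u with
  | zero =>
    obtain ⟨a, b, hab, rfl⟩ := Finset.card_eq_two.mp (by simpa using hT)
    rw [Finset.prod_pair hab, Finset.prod_pair hab, ← mul_assoc]
    refine (sq_coeff_mul_le _ _).trans (le_of_eq ?_)
    rw [map_mul, show u * f a * (gaStar G u * gaStar G (f a)) =
      (u * gaStar G u) * (f a * gaStar G (f a)) by ring, hu, one_mul]
    simp [moment]
  | succ s ih =>
    obtain ⟨U, hUT, hU⟩ := Finset.exists_subset_card_eq (s := T) (n := 2 ^ (s + 1))
      (by rw [hT]; exact Nat.pow_le_pow_right (by norm_num) (by omega))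
    have hV : (T \ U).card = 2 ^ (s + 1) := by
      rw [Finset.card_sdiff_of_subset hUT, hT, hU, pow_succ 2 (s + 1)]; omega
    have hone : (1 : AddMonoidAlgebra ℝ G) * gaStar G 1 = 1 := by simp
    have h1 := ih U hU (fun i => f i * gaStar G (f i)) 1 hone
    have h2 := ih (T \ U) hV (fun i => f i * gaStar G (f i)) 1 hone
    simp only [moment_mul_gaStar, one_mul] at h1 h2
    rw [← Finset.prod_sdiff hUT, ← Finset.prod_sdiff hUT, pow_succ' 2 (s + 1), pow_mul]
    have h3 := sq_coeff_mul_le (u * ∏ i ∈ T \ U, f i) (∏ i ∈ U, f i)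
    rw [map_mul, show ∀ a b c d : AddMonoidAlgebra ℝ G, a * b * (c * d) = (a * c) * (b * d) by
      intros; ring, hu, one_mul, map_prod, map_prod, ← Finset.prod_mul_distrib,
      ← Finset.prod_mul_distrib, mul_assoc] at h3
    refine (pow_le_pow_left₀ (sq_nonneg _) h3 _).trans ?_
    rw [mul_pow]
    refine mul_le_mul h2 h1 ?_ (Finset.prod_nonneg fun i _ => moment_nonneg _ _)
    rw [pow_succ 2 s, mul_comm, pow_mul]
    positivity

end GroupAlgebra

section Slicing

open AddMonoidAlgebra

variable {G X : Type*} [AddCommGroup G]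

/-- The weighted exponential sum `∑ x ∈ B, w x • [θ x]` in the group algebra. -/
noncomputable def expSum (θ : X → G) (B : Finset X) (w : X → ℝ) : AddMonoidAlgebra ℝ G :=
  ∑ x ∈ B, single (θ x) (w x)

lemma gaStar_expSum (θ : X → G) (B : Finset X) (w : X → ℝ) :
    gaStar G (expSum θ B w) = ∑ x ∈ B, single (-θ x) (w x) := by
  simp [expSum, gaStar_single]

lemma coeff_prod_sum_single {ι : Type*} [Fintype ι] [DecidableEq ι] [DecidableEq G]
    (B : ι → Finset X) (η : ι → X → G) (w : ι → X → ℝ) (c : G) :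
    (∏ i, ∑ x ∈ B i, single (η i x) (w i x)).coeff c =
      ∑ x ∈ Fintype.piFinset B, if ∑ i, η i (x i) = c then ∏ i, w i (x i) else 0 := by
  rw [Finset.prod_univ_sum, coeff_sum, Finsupp.finsetSum_apply]
  refine Finset.sum_congr rfl fun x _ => ?_
  rw [prod_single, coeff_single, Finsupp.single_apply]

/-- The sign attached to an index: positive for `true`, negative for `false`. -/
def signed (b : Bool) (x : G) : G := if b then x else -x

lemma moment_eq_coeff_prod (s : ℕ) (f : AddMonoidAlgebra ℝ G) :
    moment s f =
      (∏ i : Fin (2 ^ s) × Bool, if i.2 then f else gaStar G f).coeff 0 := by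
  rw [moment, Fintype.prod_prod_type]
  simp

lemma moment_ite_gaStar (s : ℕ) (f : AddMonoidAlgebra ℝ G) (b : Bool) :
    moment s (if b then f else gaStar G f) = moment s f := by
  cases b <;> simp [moment_gaStar]

lemma ite_expSum (θ : X → G) (B : Finset X) (w : X → ℝ) (b : Bool) :
    (if b then expSum θ B w else gaStar G (expSum θ B w)) =
      ∑ x ∈ B, single (signed b (θ x)) (w x) := by
  cases b
  · simp [gaStar_expSum, signed]
  · simp [expSum, signed]

/-- `B` is dissociated with constant `D` (of order `2 ^ (s + 1)`): the moments of all exponential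
sums with nonnegative weights on `B` are controlled by the `ℓ²` norm of the weights. -/
def Dissociated (s : ℕ) (θ : X → G) (B : Finset X) (D : ℝ) : Prop :=
  ∀ w : X → ℝ, (∀ x, 0 ≤ w x) → moment s (expSum θ B w) ≤ (D * ∑ x ∈ B, w x ^ 2) ^ 2 ^ s

/-- A tuple of elements of `B` whose signed sum vanishes. -/
def IsSol (s : ℕ) (θ : X → G) (B : Finset X) (x : Fin (2 ^ s) × Bool → X) : Prop :=
  (∀ i, x i ∈ B) ∧ ∑ i, signed i.2 (θ (x i)) = 0

lemma IsSol.mono {s : ℕ} {θ : X → G} {B B' : Finset X} (h : B ⊆ B')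
    {x : Fin (2 ^ s) × Bool → X} (hx : IsSol s θ B x) : IsSol s θ B' x :=
  ⟨fun i => h (hx.1 i), hx.2⟩

lemma sum_sum_filter_le {J : Type*} [DecidableEq J] (B : Finset X) (S : Finset J)
    (c : X → J) (e : J → J) (he : Function.Injective e) (u : X → ℝ) (hu : ∀ x, 0 ≤ u x) :
    ∑ a ∈ S, ∑ x ∈ B with c x = e a, u x ≤ ∑ x ∈ B, u x := by
  simp_rw [Finset.sum_filter]
  rw [Finset.sum_comm]
  refine Finset.sum_le_sum fun x _ => ?_
  rw [← Finset.sum_filter, Finset.sum_const, nsmul_eq_mul]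
  have : (S.filter fun a => c x = e a).card ≤ 1 := by
    refine Finset.card_le_one.mpr fun a ha b hb => he ?_
    rw [← (Finset.mem_filter.mp ha).2, ← (Finset.mem_filter.mp hb).2]
  calc _ ≤ ((1 : ℕ) : ℝ) * u x := by gcongr; exact hu x
    _ = u x := by simp

/-- If every vanishing signed sum over `B` has two distinct indices whose classes differ by an
element of `Δ`, then dissociation of the classes implies dissociation of `B`. -/
lemma Dissociated.of_fibers {J : Type*} [AddCommGroup J] [DecidableEq J] {s : ℕ} {θ : X → G}
    {B : Finset X} {D : ℝ} (hD : 0 ≤ D) (c : X → J) (Δ : Finset J)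
    (hpair : ∀ x, IsSol s θ B x → ∃ i j, i ≠ j ∧ c (x i) - c (x j) ∈ Δ)
    (hfib : ∀ a, Dissociated s θ (B.filter fun x => c x = a) D) :
    Dissociated s θ B ((2 ^ (s + 1)) ^ 2 * Δ.card * D) := by
  classical
  intro w hw
  set m : ℕ := 2 ^ (s + 1) with hm
  have hm0 : m ≠ 0 := by positivity
  have hm2 : m = 2 * 2 ^ s := by rw [hm, pow_succ']
  have hmge : 2 ≤ m := by rw [hm2]; have := Nat.one_le_two_pow (n := s); omega
  let ι := Fin (2 ^ s) × Bool
  have hι : Fintype.card ι = m := by simp [ι, hm, pow_succ]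
  let F : J → AddMonoidAlgebra ℝ G := fun a => expSum θ (B.filter fun x => c x = a) w
  let ν : AddMonoidAlgebra ℝ G → ℝ := fun f => moment s f ^ ((m : ℝ)⁻¹)
  have hν0 : ∀ f, 0 ≤ ν f := fun f => Real.rpow_nonneg (moment_nonneg s f) _
  have hνm : ∀ f, ν f ^ m = moment s f := fun f =>
    Real.rpow_inv_natCast_pow (moment_nonneg s f) hm0
  let W : J → ℝ := fun a => ∑ x ∈ B with c x = a, w x ^ 2
  have hW0 : ∀ a, 0 ≤ W a := fun a => Finset.sum_nonneg fun x _ => sq_nonneg _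
  have hνF : ∀ a, ν (F a) ^ 2 ≤ D * W a := by
    intro a
    have h := hfib a w hw
    rw [← hνm, hm2, pow_mul] at h
    exact le_of_pow_le_pow_left₀ (by positivity) (mul_nonneg hD (hW0 a)) h
  let S := B.image c
  -- the classes in which each coordinate lives
  let Bx : ι → ι → J → J → ι → Finset X := fun i j δ a l =>
    if l = i then B.filter (fun x => c x = a + δ)
    else if l = j then B.filter (fun x => c x = a) else B
  let P : ι → ι → J → J → ℝ := fun i j δ a =>
    (∏ l : ι, ∑ x ∈ Bx i j δ a l, single (signed l.2 (θ x)) (w x)).coeff 0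
  have hP : ∀ i j δ a, i ≠ j → P i j δ a ≤
      ν (F (a + δ)) * ν (F a) * ν (expSum θ B w) ^ (m - 2) := by
    intro i j δ a hij
    have hrhs : 0 ≤ ν (F (a + δ)) * ν (F a) * ν (expSum θ B w) ^ (m - 2) :=
      mul_nonneg (mul_nonneg (hν0 _) (hν0 _)) (pow_nonneg (hν0 _) _)
    refine le_of_pow_le_pow_left₀ hm0 hrhs ?_
    have h := pow_coeff_prod_le s (Finset.univ : Finset ι) (by rw [Finset.card_univ, hι])
      (fun l => ∑ x ∈ Bx i j δ a l, single (signed l.2 (θ x)) (w x)) 1 (by simp)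
    rw [one_mul] at h
    refine h.trans (le_of_eq ?_)
    simp_rw [← ite_expSum, moment_ite_gaStar, ← hνm]
    rw [Finset.prod_pow]
    congr 1
    rw [← Finset.mul_prod_erase _ _ (Finset.mem_univ i),
      ← Finset.mul_prod_erase _ _ (Finset.mem_erase.mpr ⟨hij.symm, Finset.mem_univ j⟩), ← mul_assoc]
    have h3 : ∀ l ∈ (Finset.univ.erase i).erase j, ν (expSum θ (Bx i j δ a l) w) =
        ν (expSum θ B w) := by
      intro l hl
      simp only [Finset.mem_erase] at hl
      simp [Bx, hl.1, hl.2.1]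
    rw [Finset.prod_congr rfl h3, Finset.prod_const,
      Finset.card_erase_of_mem (Finset.mem_erase.mpr ⟨hij.symm, Finset.mem_univ j⟩),
      Finset.card_erase_of_mem (Finset.mem_univ i), Finset.card_univ, hι]
    simp [Bx, F, hij.symm, Nat.sub_sub]
  have hmain : moment s (expSum θ B w) ≤
      ∑ i : ι, ∑ j ∈ Finset.univ.erase i, ∑ δ ∈ Δ, ∑ a ∈ S, P i j δ a := by
    have hL : moment s (expSum θ B w) = ∑ x ∈ Fintype.piFinset (fun _ : ι => B),
        if ∑ i : ι, signed i.2 (θ (x i)) = 0 then ∏ i, w (x i) else 0 := by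
      rw [moment_eq_coeff_prod]
      simp_rw [ite_expSum]
      exact coeff_prod_sum_single _ _ _ _
    have hsub : ∀ i j δ a, Fintype.piFinset (Bx i j δ a) ⊆ Fintype.piFinset fun _ : ι => B := by
      intro i j δ a
      refine Fintype.piFinset_subset _ _ fun l => ?_
      simp only [Bx]
      split_ifs <;> simp [Finset.filter_subset]
    have hPe : ∀ i j δ a, P i j δ a = ∑ x ∈ Fintype.piFinset (fun _ : ι => B),
        if x ∈ Fintype.piFinset (Bx i j δ a) then
          (if ∑ i : ι, signed i.2 (θ (x i)) = 0 then ∏ i, w (x i) else 0) else 0 := by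
      intro i j δ a
      rw [← Finset.sum_filter, Finset.filter_mem_eq_inter,
        Finset.inter_eq_right.mpr (hsub i j δ a)]
      exact coeff_prod_sum_single _ _ _ _
    simp_rw [hPe]
    have hcomm : ∀ T : ι → ι → J → J → (ι → X) → ℝ,
        ∑ i : ι, ∑ j ∈ Finset.univ.erase i, ∑ δ ∈ Δ, ∑ a ∈ S,
          ∑ x ∈ Fintype.piFinset (fun _ : ι => B), T i j δ a x =
        ∑ x ∈ Fintype.piFinset (fun _ : ι => B), ∑ i : ι, ∑ j ∈ Finset.univ.erase i,
          ∑ δ ∈ Δ, ∑ a ∈ S, T i j δ a x := by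
      intro T
      symm
      refine Finset.sum_comm.trans (Finset.sum_congr rfl fun i _ => ?_)
      refine Finset.sum_comm.trans (Finset.sum_congr rfl fun j _ => ?_)
      refine Finset.sum_comm.trans (Finset.sum_congr rfl fun δ _ => ?_)
      exact Finset.sum_comm
    rw [hcomm, hL]
    refine Finset.sum_le_sum fun x hx => ?_
    have hxB : ∀ i, x i ∈ B := fun i => Fintype.mem_piFinset.mp hx i
    have hT0 : ∀ i j δ a, (0 : ℝ) ≤ if x ∈ Fintype.piFinset (Bx i j δ a) then
          (if ∑ i : ι, signed i.2 (θ (x i)) = 0 then ∏ i, w (x i) else 0) else 0 := by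
      intro i j δ a
      have := Finset.prod_nonneg fun i (_ : i ∈ (Finset.univ : Finset ι)) => hw (x i)
      split_ifs <;> simp [this]
    by_cases hs : ∑ i : ι, signed i.2 (θ (x i)) = 0
    · obtain ⟨i, j, hij, hδ⟩ := hpair x ⟨hxB, hs⟩
      have hmem : x ∈ Fintype.piFinset (Bx i j (c (x i) - c (x j)) (c (x j))) := by
        refine Fintype.mem_piFinset.mpr fun l => ?_
        simp only [Bx]
        split_ifs with h1 h2
        · subst h1; simp [hxB]
        · subst h2; simp [hxB]
        · exact hxB l
      let T : ι → ι → J → J → ℝ := fun i j δ a => if x ∈ Fintype.piFinset (Bx i j δ a) then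
          (if ∑ i : ι, signed i.2 (θ (x i)) = 0 then ∏ i, w (x i) else 0) else 0
      have hT0 : ∀ i j δ a, 0 ≤ T i j δ a := hT0
      calc (if ∑ i : ι, signed i.2 (θ (x i)) = 0 then ∏ i, w (x i) else 0)
          = T i j (c (x i) - c (x j)) (c (x j)) := (if_pos hmem).symm
        _ ≤ ∑ a ∈ S, T i j (c (x i) - c (x j)) a :=
          Finset.single_le_sum (f := fun a => T i j (c (x i) - c (x j)) a)
            (fun a _ => hT0 _ _ _ a) (Finset.mem_image_of_mem c (hxB j))
        _ ≤ ∑ δ ∈ Δ, ∑ a ∈ S, T i j δ a :=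
          Finset.single_le_sum (f := fun δ => ∑ a ∈ S, T i j δ a)
            (fun δ _ => Finset.sum_nonneg fun a _ => hT0 _ _ _ a) hδ
        _ ≤ ∑ j ∈ Finset.univ.erase i, ∑ δ ∈ Δ, ∑ a ∈ S, T i j δ a :=
          Finset.single_le_sum (f := fun j => ∑ δ ∈ Δ, ∑ a ∈ S, T i j δ a)
            (fun j _ => Finset.sum_nonneg fun δ _ => Finset.sum_nonneg fun a _ => hT0 _ _ _ a)
            (Finset.mem_erase.mpr ⟨hij.symm, Finset.mem_univ j⟩)
        _ ≤ _ :=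
          Finset.single_le_sum
            (f := fun i => ∑ j ∈ Finset.univ.erase i, ∑ δ ∈ Δ, ∑ a ∈ S, T i j δ a)
            (fun i _ => Finset.sum_nonneg fun j _ => Finset.sum_nonneg fun δ _ =>
              Finset.sum_nonneg fun a _ => hT0 _ _ _ a) (Finset.mem_univ i)
    · rw [if_neg hs]
      exact Finset.sum_nonneg fun i _ => Finset.sum_nonneg fun j _ => Finset.sum_nonneg fun δ _ =>
          Finset.sum_nonneg fun a _ => by simp
  set y := ν (expSum θ B w) with hy
  set Wt := ∑ x ∈ B, w x ^ 2 with hWt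
  have hWt0 : 0 ≤ Wt := Finset.sum_nonneg fun x _ => sq_nonneg _
  have hsum : ∀ i j : ι, i ≠ j → ∀ δ, ∑ a ∈ S, P i j δ a ≤ D * Wt * y ^ (m - 2) := by
    intro i j hij δ
    calc ∑ a ∈ S, P i j δ a ≤ ∑ a ∈ S, (D * W (a + δ) + D * W a) / 2 * y ^ (m - 2) := by
          refine Finset.sum_le_sum fun a _ => (hP i j δ a hij).trans ?_
          refine mul_le_mul_of_nonneg_right ?_ (pow_nonneg (hν0 _) _)
          nlinarith [hνF a, hνF (a + δ), sq_nonneg (ν (F a) - ν (F (a + δ)))]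
      _ = D * ((∑ a ∈ S, W (a + δ) + ∑ a ∈ S, W a) / 2) * y ^ (m - 2) := by
          rw [← Finset.sum_mul, ← Finset.sum_div, Finset.sum_add_distrib, ← Finset.mul_sum,
            ← Finset.mul_sum]
          ring
      _ ≤ D * Wt * y ^ (m - 2) := by
          have h1 : ∑ a ∈ S, W (a + δ) ≤ Wt := sum_sum_filter_le B S c (fun a => a + δ)
            (add_left_injective δ) _ fun x => sq_nonneg _
          have h2 : ∑ a ∈ S, W a ≤ Wt := sum_sum_filter_le B S c (fun a => a)
            (fun _ _ h => h) _ fun x => sq_nonneg _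
          have h3 : (∑ a ∈ S, W (a + δ) + ∑ a ∈ S, W a) / 2 ≤ Wt := by linarith
          have := pow_nonneg (hν0 (expSum θ B w)) (m - 2)
          gcongr
  have hfin : y ^ m ≤ (m ^ 2 * Δ.card * D * Wt) * y ^ (m - 2) := by
    rw [hνm]
    refine hmain.trans ?_
    have hc0 : 0 ≤ D * Wt * y ^ (m - 2) :=
      mul_nonneg (mul_nonneg hD hWt0) (pow_nonneg (hν0 _) _)
    calc _ ≤ ∑ i : ι, ∑ j ∈ Finset.univ.erase i, ∑ δ ∈ Δ, D * Wt * y ^ (m - 2) :=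
          Finset.sum_le_sum fun i _ => Finset.sum_le_sum fun j hj => Finset.sum_le_sum fun δ _ =>
            hsum i j (Finset.ne_of_mem_erase hj).symm δ
      _ ≤ ∑ i : ι, ∑ j : ι, ∑ δ ∈ Δ, D * Wt * y ^ (m - 2) :=
          Finset.sum_le_sum fun i _ => Finset.sum_le_sum_of_subset_of_nonneg
            (Finset.erase_subset _ _) fun j _ _ => Finset.sum_nonneg fun _ _ => hc0
      _ = _ := by
          simp only [Finset.sum_const, Finset.card_univ, hι, nsmul_eq_mul]
          ring
  have hy0 : 0 ≤ y := hν0 _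
  have hy2 : y ^ 2 ≤ m ^ 2 * Δ.card * D * Wt := by
    rcases hy0.eq_or_lt with h | h
    · rw [← h]; simp only [ne_eq, OfNat.ofNat_ne_zero, not_false_eq_true, zero_pow]; positivity
    · refine le_of_mul_le_mul_right ?_ (pow_pos h (m - 2))
      rwa [← pow_add, Nat.add_sub_cancel' hmge]
  rw [← hνm, ← hy, hm2, pow_mul]
  refine pow_le_pow_left₀ (sq_nonneg _) ?_ _
  refine hy2.trans (le_of_eq ?_)
  rw [hm]; push_cast; ring

/-- Iterated version of `Dissociated.of_fibers` along a list of classifications. -/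
lemma Dissociated.of_list {J : Type*} [AddCommGroup J] [DecidableEq J] {s : ℕ} {θ : X → G}
    {D : ℝ} (hD : 0 ≤ D) (Δ : Finset J) (l : List (X → J)) (B : Finset X)
    (hpair : ∀ c ∈ l, ∀ x, IsSol s θ B x → ∃ i j, i ≠ j ∧ c (x i) - c (x j) ∈ Δ)
    (hcell : ∀ Q ⊆ B, (∀ c ∈ l, ∀ x ∈ Q, ∀ y ∈ Q, c x = c y) → Dissociated s θ Q D) :
    Dissociated s θ B (((2 ^ (s + 1)) ^ 2 * Δ.card) ^ l.length * D) := by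
  induction l generalizing B with
  | nil => simpa using hcell B subset_rfl (by simp)
  | cons c l ih =>
    have h := Dissociated.of_fibers (s := s) (θ := θ) (B := B)
      (D := ((2 ^ (s + 1)) ^ 2 * Δ.card) ^ l.length * D) (by positivity) c Δ
      (hpair c (by simp)) fun a => ih _ (fun c' hc' x hx =>
        hpair c' (by simp [hc']) x (hx.mono (Finset.filter_subset _ _))) fun Q hQ hQc =>
        hcell Q (hQ.trans (Finset.filter_subset _ _)) fun c' hc' x hx y hy => by
          rcases List.mem_cons.mp hc' with rfl | hc'
          · rw [(Finset.mem_filter.mp (hQ hx)).2, (Finset.mem_filter.mp (hQ hy)).2]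
          · exact hQc c' hc' x hx y hy
    rw [List.length_cons, pow_succ']
    simpa [mul_assoc] using h

/-- A set of cardinality at most `N` is dissociated with constant `N`. -/
lemma Dissociated.of_card_le {s : ℕ} {θ : X → G} {B : Finset X} {N : ℕ} (hN : B.card ≤ N) :
    Dissociated s θ B N := by
  classical
  intro w hw
  have h1 : moment s (expSum θ B w) ≤ (∑ x ∈ B, w x) ^ (2 ^ (s + 1)) := by
    rw [moment_eq_coeff_prod]
    simp_rw [ite_expSum]
    rw [coeff_prod_sum_single]
    calc _ ≤ ∑ x ∈ Fintype.piFinset (fun _ : Fin (2 ^ s) × Bool => B), ∏ i, w (x i) := by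
          refine Finset.sum_le_sum fun x _ => ?_
          split_ifs
          · exact le_rfl
          · exact Finset.prod_nonneg fun i _ => hw _
      _ = _ := by
          rw [← Finset.prod_univ_sum]
          simp [pow_succ]
  refine h1.trans ?_
  rw [pow_succ', pow_mul]
  refine pow_le_pow_left₀ (sq_nonneg _) ?_ _
  refine (sq_sum_le_card_mul_sum_sq (s := B) (f := w)).trans ?_
  have : (B.card : ℝ) ≤ N := by exact_mod_cast hN
  gcongr

end Slicing

section SmallUnits

open NumberField

lemma dvd_sum_pow_sub_sum_pow {R ι : Type*} [CommRing R] {p : ℕ} (hp : p.Prime) (S : Finset ι)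
    (t : ι → R) : (p : R) ∣ (∑ i ∈ S, t i) ^ p - ∑ i ∈ S, t i ^ p := by
  classical
  induction S using Finset.induction_on with
  | empty => simp [hp.ne_zero]
  | insert a S ha ih =>
    obtain ⟨r, hr⟩ := exists_add_pow_prime_eq hp (t a) (∑ i ∈ S, t i)
    obtain ⟨r', hr'⟩ := ih
    rw [Finset.sum_insert ha, Finset.sum_insert ha, hr]
    refine ⟨t a * (∑ i ∈ S, t i) * r + r', ?_⟩
    linear_combination hr'

variable {L : Type*} [Field L] [NumberField L] {ι : Type*} [Fintype ι]

/-- If `m` algebraic integers with all archimedean absolute values close to `1` sum to zero, then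
so do their `q`-th powers for every moderately sized `q` free of prime factors up to `m`. -/
lemma sum_pow_eq_zero_of_small {m Q : ℕ} (hm : Fintype.card ι = m) {E : ℝ} (hE : 1 ≤ E)
    (hEm : m * E ^ Q < m + 1) (t : ι → 𝓞 L) (ht : ∀ (w : InfinitePlace L) i, w (t i : L) ≤ E)
    (hsum : ∑ i, t i = 0) (q : ℕ) (hq0 : q ≠ 0) (hq : q ≤ Q)
    (hqp : ∀ p, p.Prime → p ∣ q → m < p) : ∑ i, t i ^ q = 0 := by
  induction q using Nat.strong_induction_on with
  | _ q ih =>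
    by_cases h1 : q = 1
    · simpa [h1] using hsum
    set p := q.minFac with hpdef
    have hp : p.Prime := Nat.minFac_prime h1
    obtain ⟨r, hr⟩ : p ∣ q := Nat.minFac_dvd q
    have hmp : m < p := hqp p hp (Nat.minFac_dvd q)
    have hr0 : r ≠ 0 := fun h => hq0 (by rw [hr, h, mul_zero])
    have hrq : r < q := by
      rw [hr]; exact lt_mul_of_one_lt_left (Nat.pos_of_ne_zero hr0) hp.one_lt
    have hIH := ih r hrq hr0 (hrq.le.trans hq) fun p' hp' hd => hqp p' hp' (hr ▸ hd.mul_left p)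
    have hdvd := dvd_sum_pow_sub_sum_pow hp Finset.univ fun i => t i ^ r
    rw [hIH, zero_pow hp.ne_zero, zero_sub, dvd_neg] at hdvd
    simp_rw [← pow_mul, mul_comm r p, ← hr] at hdvd
    obtain ⟨u, hu⟩ := hdvd
    have hw : ∀ w : InfinitePlace L, w (u : L) < 1 := by
      intro w
      have hp0 : (0 : ℝ) < p := by exact_mod_cast hp.pos
      have h2 : w ((∑ i, t i ^ q : 𝓞 L) : L) = p * w (u : L) := by
        rw [hu]; push_cast; rw [map_mul, InfinitePlace.map_natCast]
      have h3 : w ((∑ i, t i ^ q : 𝓞 L) : L) ≤ m * E ^ Q := by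
        push_cast
        calc w (∑ i, (t i : L) ^ q) ≤ ∑ i, w ((t i : L) ^ q) := by
              exact w.1.sum_le _ _
          _ ≤ ∑ i : ι, E ^ Q := by
              refine Finset.sum_le_sum fun i _ => ?_
              rw [map_pow]
              exact (pow_le_pow_left₀ (apply_nonneg _ _) (ht w i) q).trans
                (pow_le_pow_right₀ hE hq)
          _ = _ := by simp [hm]
      have h4 : (m : ℝ) + 1 ≤ p := by exact_mod_cast hmp
      by_contra! h5
      nlinarith
    have hu0 : u = 0 := by
      by_contra h
      obtain ⟨w⟩ : Nonempty (InfinitePlace L) := inferInstance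
      exact absurd (InfinitePlace.one_le_of_lt_one (w := w) h fun z _ => hw z) (not_le.mpr (hw w))
    rw [hu, hu0, mul_zero]

/-- A vanishing sum of `m` nonzero algebraic integers, all of whose archimedean absolute values are
close to `1`, contains two terms with the same power of exponent `m !`. -/
lemma exists_pow_factorial_eq_of_small {m : ℕ} (hm : Fintype.card ι = m) (hm0 : m ≠ 0) {E : ℝ}
    (hE : 1 ≤ E) (hEm : m * E ^ (1 + m * m.factorial) < m + 1) (t : ι → 𝓞 L)
    (ht0 : ∀ i, t i ≠ 0) (ht : ∀ (w : InfinitePlace L) i, w (t i : L) ≤ E)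
    (hsum : ∑ i, t i = 0) : ∃ i j, i ≠ j ∧ t i ^ m.factorial = t j ^ m.factorial := by
  by_contra! hne
  let e : Fin m ≃ ι := (finCongr hm.symm).trans (Fintype.equivFin ι).symm
  have hinj : Function.Injective fun i : Fin m => t (e i) ^ m.factorial := by
    intro i j hij
    by_contra h
    exact hne _ _ (fun h' => h (e.injective h')) hij
  have hv := Matrix.eq_zero_of_forall_pow_sum_mul_pow_eq_zero (v := fun i => t (e i)) hinj (by
    intro k
    have := sum_pow_eq_zero_of_small hm hE hEm t ht hsum (1 + k * m.factorial) (by omega)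
      (by have := k.2; gcongr) (by
        intro p hp hd
        by_contra! h
        have h2 : p ∣ k * m.factorial := (Nat.dvd_factorial hp.pos h).mul_left _
        exact hp.one_lt.ne' (Nat.dvd_one.mp ((Nat.dvd_add_left h2).mp hd)))
    rw [← this, ← e.sum_comp]
    refine Finset.sum_congr rfl fun i _ => ?_
    ring)
  exact ht0 _ (congr_fun hv ⟨0, Nat.pos_of_ne_zero hm0⟩)

lemma exists_abv_eq_of_sum_eq_zero {F : Type*} [Field F] (v : AbsoluteValue F ℝ)
    (hv : IsNonarchimedean v) [Nonempty ι] (t : ι → F) (ht0 : ∀ i, t i ≠ 0)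
    (hsum : ∑ i, t i = 0) : ∃ i j, i ≠ j ∧ v (t i) = v (t j) := by
  obtain ⟨i, hi⟩ := Finite.exists_max fun i => v (t i)
  by_contra! hne
  have h := IsNonarchimedean.apply_sum_eq_of_lt hv (fun a => (v.map_neg a).symm) (s := Finset.univ) (l := t) (k := i)
    (Finset.mem_univ i) fun j _ hj => lt_of_le_of_ne (hi j) (hne j i hj)
  rw [hsum, map_zero] at h
  exact ht0 i (by simpa using h.symm)

lemma exists_abs_log_abv_sub_le_of_sum_eq_zero {F : Type*} [Field F] (v : AbsoluteValue F ℝ)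
    [Nonempty ι] (t : ι → F) (ht0 : ∀ i, t i ≠ 0) (hsum : ∑ i, t i = 0) :
    ∃ i j, i ≠ j ∧ |Real.log (v (t i)) - Real.log (v (t j))| ≤ Real.log (Fintype.card ι) := by
  classical
  obtain ⟨i, hi⟩ := Finite.exists_max fun i => v (t i)
  have hpos : ∀ j, 0 < v (t j) := fun j => v.pos (ht0 j)
  have hm : (0 : ℝ) < Fintype.card ι := by exact_mod_cast Fintype.card_pos
  obtain ⟨j, hj, hle⟩ : ∃ j ∈ Finset.univ.erase i, v (t i) / Fintype.card ι ≤ v (t j) := by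
    by_contra! h
    have h1 : t i = -∑ j ∈ Finset.univ.erase i, t j := by
      rw [← Finset.add_sum_erase _ _ (Finset.mem_univ i)] at hsum
      exact eq_neg_of_add_eq_zero_left hsum
    have h2 : v (t i) ≤ ∑ j ∈ Finset.univ.erase i, v (t j) := by
      conv_lhs => rw [h1, v.map_neg]
      exact v.sum_le _ _
    have h3 : ∑ j ∈ Finset.univ.erase i, v (t j) ≤
        ∑ j ∈ Finset.univ.erase i, v (t i) / Fintype.card ι :=
      Finset.sum_le_sum fun j hj => (h j hj).le
    rw [Finset.sum_const, Finset.card_erase_of_mem (Finset.mem_univ i), Finset.card_univ,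
      nsmul_eq_mul, Nat.cast_sub Fintype.card_pos, Nat.cast_one] at h3
    have h4 : 0 < v (t i) / Fintype.card ι := div_pos (hpos i) hm
    have h5 : (Fintype.card ι : ℝ) * (v (t i) / Fintype.card ι) = v (t i) := by field_simp
    linarith
  refine ⟨i, j, (Finset.ne_of_mem_erase hj).symm, ?_⟩
  rw [abs_of_nonneg (sub_nonneg.mpr (Real.log_le_log (hpos j) (hi j))), ← Real.log_div
    (hpos i).ne' (hpos j).ne']
  refine Real.log_le_log (div_pos (hpos i) (hpos j)) ?_
  rw [div_le_iff₀ (hpos j)]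
  rwa [div_le_iff₀ hm, mul_comm] at hle

/-- A finite family of linear forms in `ρ` variables contains at most `ρ` members whose values
control the values of all the others, with a constant depending only on `ρ`. -/
lemma exists_controlling_forms {V : Type*} [Finite V] (ρ : ℕ) (f : V → Fin ρ → ℝ) :
    ∃ l : List V, l.length ≤ ρ ∧ ∀ (z : Fin ρ → ℝ) (δ : ℝ), (∀ v ∈ l, |∑ s, f v s * z s| ≤ δ) →
      0 ≤ δ → ∀ v, |∑ s, f v s * z s| ≤ 3 ^ ρ * δ := by
  induction ρ with
  | zero => exact ⟨[], by simp, fun z δ _ hδ v => by simpa using hδ⟩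
  | succ ρ ih =>
    cases isEmpty_or_nonempty V
    · exact ⟨[], by simp, fun z δ _ _ v => isEmptyElim v⟩
    obtain ⟨v₀, hv₀⟩ := Finite.exists_max fun v => |f v 0|
    obtain ⟨l, hl, hc⟩ := ih fun v s => f v s.succ - f v 0 / f v₀ 0 * f v₀ s.succ
    refine ⟨v₀ :: l, by simpa using hl, fun z δ hz hδ => ?_⟩
    have hratio : ∀ v, |f v 0 / f v₀ 0| ≤ 1 := fun v => by
      rw [abs_div]; exact div_le_one_of_le₀ (hv₀ v) (abs_nonneg _)
    have hkey : ∀ v, ∑ s : Fin ρ, (f v s.succ - f v 0 / f v₀ 0 * f v₀ s.succ) * z s.succ =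
        ∑ s, f v s * z s - f v 0 / f v₀ 0 * ∑ s, f v₀ s * z s := by
      intro v
      have h0 : f v 0 / f v₀ 0 * f v₀ 0 = f v 0 := by
        by_cases h : f v₀ 0 = 0
        · have := hv₀ v
          rw [h, abs_zero] at this
          rw [h, abs_nonpos_iff.mp this]; simp
        · field_simp
      rw [Fin.sum_univ_succ, Fin.sum_univ_succ, Finset.sum_congr rfl fun s _ => sub_mul _ _ _,
        Finset.sum_sub_distrib, mul_add, Finset.mul_sum, ← mul_assoc, h0]
      simp_rw [mul_assoc]
      ring
    have hv0δ := hz v₀ (by simp)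
    have hterm : ∀ v, |f v 0 / f v₀ 0 * ∑ s, f v₀ s * z s| ≤ δ := fun v => by
      rw [abs_mul]
      calc _ ≤ 1 * δ := by gcongr; exact hratio v
        _ = δ := one_mul δ
    have h := hc (fun s => z s.succ) (2 * δ) (fun v hv => by
      rw [hkey]
      have h1 := hz v (by simp [hv])
      have h2 := abs_sub (∑ s, f v s * z s) (f v 0 / f v₀ 0 * ∑ s, f v₀ s * z s)
      linarith [hterm v]) (by positivity)
    intro v
    have h1 := h v
    rw [hkey] at h1
    have h2 := abs_sub_abs_le_abs_sub (∑ s, f v s * z s) (f v 0 / f v₀ 0 * ∑ s, f v₀ s * z s)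
    have h3 : (1 : ℝ) ≤ 3 ^ ρ := one_le_pow₀ (by norm_num)
    have h4 : δ ≤ 3 ^ ρ * δ := le_mul_of_one_le_left hδ h3
    rw [pow_succ]
    linarith [hterm v]

/-- A family of linear forms in `ρ` variables contains at most `ρ` members whose common zeros are
zeros of all the others. -/
lemma exists_spanning_forms {V : Type*} (ρ : ℕ) (f : V → Fin ρ → ℝ) :
    ∃ l : List V, l.length ≤ ρ ∧ ∀ z : Fin ρ → ℝ, (∀ v ∈ l, ∑ s, f v s * z s = 0) →
      ∀ v, ∑ s, f v s * z s = 0 := by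
  induction ρ with
  | zero => exact ⟨[], by simp, fun z _ v => by simp⟩
  | succ ρ ih =>
    by_cases h : ∃ v₀, f v₀ 0 ≠ 0
    · obtain ⟨v₀, hv₀⟩ := h
      obtain ⟨l, hl, hc⟩ := ih fun v s => f v s.succ - f v 0 / f v₀ 0 * f v₀ s.succ
      refine ⟨v₀ :: l, by simpa using hl, fun z hz => ?_⟩
      have h0 := hz v₀ (by simp)
      have hkey : ∀ v, ∑ s : Fin ρ, (f v s.succ - f v 0 / f v₀ 0 * f v₀ s.succ) * z s.succ =
          ∑ s, f v s * z s - f v 0 / f v₀ 0 * ∑ s, f v₀ s * z s := by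
        intro v
        rw [Fin.sum_univ_succ, Fin.sum_univ_succ, Finset.sum_congr rfl fun s _ => sub_mul _ _ _,
          Finset.sum_sub_distrib, mul_add, Finset.mul_sum, ← mul_assoc, div_mul_cancel₀ _ hv₀]
        simp_rw [mul_assoc]
        ring
      intro v
      have := hc (fun s => z s.succ) (fun v hv => by
        rw [hkey, hz v (by simp [hv]), h0]; simp) v
      rwa [hkey, h0, mul_zero, sub_zero] at this
    · push Not at h
      obtain ⟨l, hl, hc⟩ := ih fun v s => f v s.succ
      refine ⟨l, by omega, fun z hz v => ?_⟩
      have := hc (fun s => z s.succ) (fun v hv => by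
        have := hz v hv
        rwa [Fin.sum_univ_succ, h, zero_mul, zero_add] at this) v
      rw [Fin.sum_univ_succ, h, zero_mul, zero_add, this]

end SmallUnits

section NumberFieldDissociated

open NumberField IsDedekindDomain

lemma map_signed {G G' F : Type*} [AddCommGroup G] [AddCommGroup G'] [FunLike F G G']
    [AddMonoidHomClass F G G'] (h : F) (b : Bool) (x : G) : h (signed b x) = signed b (h x) := by
  cases b <;> simp [signed]

lemma mul_signed {F : Type*} [CommRing F] (b : Bool) (a x : F) :
    a * signed b x = signed b (a * x) := by
  cases b <;> simp [signed]

lemma signed_ne_zero {F : Type*} [AddCommGroup F] {b : Bool} {x : F} (hx : x ≠ 0) :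
    signed b x ≠ 0 := by
  cases b <;> simpa [signed] using hx

lemma signed_pow_of_even {F : Type*} [CommRing F] {n : ℕ} (hn : Even n) (b : Bool) (x : F) :
    signed b x ^ n = x ^ n := by
  cases b <;> simp [signed, hn.neg_pow]

lemma AbsoluteValue.map_signed {F : Type*} [CommRing F] [IsDomain F] (v : AbsoluteValue F ℝ)
    (b : Bool) (x : F) : v (signed b x) = v x := by
  cases b <;> simp [signed]

lemma Dissociated.mono {G X : Type*} [AddCommGroup G] {s : ℕ} {θ : X → G} {B : Finset X}
    {D D' : ℝ} (hD : 0 ≤ D) (hDD' : D ≤ D') (h : Dissociated s θ B D) : Dissociated s θ B D' := by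
  intro w hw
  refine (h w hw).trans ?_
  have h0 : 0 ≤ ∑ x ∈ B, w x ^ 2 := Finset.sum_nonneg fun x _ => sq_nonneg _
  gcongr

lemma exists_pos_mul_exp_pow_lt (m Q : ℕ) : ∃ ε : ℝ, 0 < ε ∧ m * Real.exp ε ^ Q < m + 1 := by
  have hc : Continuous fun ε : ℝ => m * Real.exp ε ^ Q := by fun_prop
  have h0 : (m : ℝ) * Real.exp 0 ^ Q < m + 1 := by simp
  obtain ⟨δ, hδ, h⟩ := Metric.mem_nhds_iff.mp ((hc.tendsto 0).eventually_lt_const h0)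
  exact ⟨δ / 2, by positivity, h (by simp [abs_of_pos hδ, hδ])⟩

lemma exists_ringOfIntegers_eq {L : Type*} [Field L] [NumberField L] (z : L)
    (hz : ∀ v : HeightOneSpectrum (𝓞 L), HeightOneSpectrum.adicAbv L v z ≤ 1) :
    ∃ t : 𝓞 L, algebraMap (𝓞 L) L t = z := by
  refine HeightOneSpectrum.mem_integers_of_valuation_le_one L z fun v => ?_
  have h := hz v
  rw [HeightOneSpectrum.adicAbv_def] at h
  rw [← (WithZeroMulInt.toNNReal_strictMono
    (HeightOneSpectrum.one_lt_absNorm_nnreal v)).le_iff_le, map_one]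
  exact_mod_cast h

/-- A finite set whose elements have nearly the same absolute values at all places
is dissociated. -/
lemma Dissociated.of_abv_close (s : ℕ) : ∃ ε : ℝ, 0 < ε ∧
    ∀ {L X G : Type*} [Field L] [NumberField L] [AddCommGroup G] (θ : X → G) (B : Finset X)
      (φ : X → L), Set.InjOn φ B → (∀ x ∈ B, φ x ≠ 0) →
      (∀ x, IsSol s θ B x → ∑ i, signed i.2 (φ (x i)) = 0) →
      (∀ v : HeightOneSpectrum (𝓞 L), ∀ x ∈ B, ∀ y ∈ B,
        HeightOneSpectrum.adicAbv L v (φ x) = HeightOneSpectrum.adicAbv L v (φ y)) →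
      (∀ w : InfinitePlace L, ∀ x ∈ B, ∀ y ∈ B,
        Real.log (w (φ x)) - Real.log (w (φ y)) ≤ ε) →
      Dissociated s θ B ((2 ^ (s + 1)) ^ 2 * (2 ^ (s + 1)).factorial) := by
  obtain ⟨ε, hε, hεm⟩ := exists_pos_mul_exp_pow_lt (2 ^ (s + 1))
    (1 + 2 ^ (s + 1) * (2 ^ (s + 1)).factorial)
  refine ⟨ε, hε, ?_⟩
  intro L X G _ _ _ θ B φ hinj hφ0 hsol hfin hinf
  classical
  have heven : Even (2 ^ (s + 1)).factorial :=
    even_iff_two_dvd.mpr (Nat.dvd_factorial (by norm_num) (by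
      rw [pow_succ']; have := Nat.one_le_two_pow (n := s); omega))
  have hmain := Dissociated.of_fibers (s := s) (θ := θ) (B := B)
    (D := ((2 ^ (s + 1)).factorial : ℕ)) (by positivity)
    (fun x => φ x ^ (2 ^ (s + 1)).factorial) {0} ?_ ?_
  · simpa using hmain
  · intro x hx
    have hxB := hx.1
    let i₀ : Fin (2 ^ s) × Bool := (⟨0, by positivity⟩, true)
    have hne : ∀ i, φ (x i) ≠ 0 := fun i => hφ0 _ (hxB i)
    have ht : ∀ i, ∃ t : 𝓞 L,
        algebraMap (𝓞 L) L t = signed i.2 (φ (x i)) / φ (x i₀) := by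
      intro i
      refine exists_ringOfIntegers_eq _ fun v => ?_
      rw [map_div₀, AbsoluteValue.map_signed, hfin v _ (hxB i) _ (hxB i₀), div_self]
      exact (map_ne_zero _).mpr (hne _)
    choose t ht using ht
    obtain ⟨i, j, hij, h⟩ := exists_pow_factorial_eq_of_small (ι := Fin (2 ^ s) × Bool)
      (m := 2 ^ (s + 1)) (by simp [pow_succ]) (by positivity) (Real.one_le_exp hε.le)
      (by exact_mod_cast hεm) t (fun i h => by
        have := ht i
        rw [h, map_zero] at this
        exact div_ne_zero (signed_ne_zero (hne i)) (hne i₀) this.symm)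
      (fun w i => by
        change w (algebraMap (𝓞 L) L (t i)) ≤ _
        rw [ht, map_div₀]
        have h1 : w (signed i.2 (φ (x i))) = w (φ (x i)) := AbsoluteValue.map_signed w.1 _ _
        have h2 : ∀ i, 0 < w (φ (x i)) := fun i => InfinitePlace.pos_iff.mpr (hne i)
        rw [h1, ← Real.log_le_iff_le_exp (div_pos (h2 _) (h2 _)),
          Real.log_div (h2 _).ne' (h2 _).ne']
        exact hinf w _ (hxB i) _ (hxB i₀))
      (by
        refine FaithfulSMul.algebraMap_injective (𝓞 L) L ?_
        rw [map_sum, map_zero]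
        simp_rw [ht]
        rw [← Finset.sum_div, hsol x hx, zero_div])
    refine ⟨i, j, hij, ?_⟩
    have h' := congr_arg (algebraMap (𝓞 L) L) h
    rw [map_pow, map_pow, ht, ht, div_pow, div_pow, signed_pow_of_even heven,
      signed_pow_of_even heven, div_left_inj' (pow_ne_zero _ (hne i₀))] at h'
    simp [h']
  · intro a
    refine Dissociated.of_card_le ?_
    rw [← Finset.card_image_of_injOn (f := φ) (hinj.mono (by
      intro x hx; exact (Finset.mem_filter.mp hx).1))]
    refine le_trans (Finset.card_le_card (t := (Polynomial.nthRoots _ a).toFinset) ?_)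
      ((Multiset.toFinset_card_le _).trans (Polynomial.card_nthRoots (2 ^ (s + 1)).factorial a))
    intro z hz
    obtain ⟨x, hx, rfl⟩ := Finset.mem_image.mp hz
    rw [Multiset.mem_toFinset, Polynomial.mem_nthRoots (Nat.factorial_pos _)]
    exact (Finset.mem_filter.mp hx).2

/-- A finite set of elements of a number field whose logarithmic absolute values depend linearly
on `ρ` parameters is dissociated, with a constant depending only on `ρ`. -/
lemma Dissociated.of_numberField (s ρ : ℕ) : ∃ D : ℝ, 0 ≤ D ∧
    ∀ {L X G : Type*} [Field L] [NumberField L] [AddCommGroup G] (θ : X → G) (B : Finset X)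
      (φ : X → L) (q : X → Fin ρ → ℝ) (g : Fin ρ → L), Set.InjOn φ B → (∀ x ∈ B, φ x ≠ 0) →
      (∀ x, IsSol s θ B x → ∑ i, signed i.2 (φ (x i)) = 0) →
      (∀ v : AbsoluteValue L ℝ, ∀ x ∈ B,
        Real.log (v (φ x)) = ∑ j, Real.log (v (g j)) * q x j) →
      Dissociated s θ B D := by
  obtain ⟨ε, hε, hcell⟩ := Dissociated.of_abv_close s
  set m : ℕ := 2 ^ (s + 1) with hm
  have hm1 : 1 ≤ m := Nat.one_le_two_pow
  set η : ℝ := ε / 3 ^ ρ with hη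
  have hη0 : 0 < η := by positivity
  obtain ⟨M, hM⟩ := exists_nat_ge (Real.log m / η + 1)
  let Δ : Finset ℤ := Finset.Icc (-M) M
  have hΔ : (1 : ℝ) ≤ Δ.card := by
    have : 0 < Δ.card := Finset.card_pos.mpr ⟨0, by simp [Δ]⟩
    exact_mod_cast this
  have hm1' : (1 : ℝ) ≤ m := by exact_mod_cast hm1
  set D₀ : ℝ := (m : ℝ) ^ 2 * m.factorial with hD₀
  have hD₀0 : 0 ≤ D₀ := by positivity
  set D₁ : ℝ := ((m : ℝ) ^ 2) ^ ρ * D₀ with hD₁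
  refine ⟨((m : ℝ) ^ 2 * Δ.card) ^ ρ * D₁, by positivity, ?_⟩
  intro L X G _ _ _ θ B φ q g hinj hφ0 hsol hlog
  classical
  have hcard : Fintype.card (Fin (2 ^ s) × Bool) = m := by simp [hm, pow_succ]
  obtain ⟨li, hli, hci⟩ := exists_controlling_forms ρ fun (w : InfinitePlace L) j =>
    Real.log (w (g j))
  obtain ⟨lf, hlf, hcf⟩ := exists_spanning_forms ρ fun (v : HeightOneSpectrum (𝓞 L)) j =>
    Real.log (HeightOneSpectrum.adicAbv L v (g j))
  have hinst : Nonempty (Fin (2 ^ s) × Bool) := ⟨(⟨0, by positivity⟩, true)⟩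
  have hdiff : ∀ (v : AbsoluteValue L ℝ), ∀ x ∈ B, ∀ y ∈ B,
      ∑ j, Real.log (v (g j)) * (q x j - q y j) = Real.log (v (φ x)) - Real.log (v (φ y)) := by
    intro v x hx y hy
    simp_rw [mul_sub]
    rw [Finset.sum_sub_distrib, hlog v x hx, hlog v y hy]
  have hinfcell := Dissociated.of_list (s := s) (θ := θ) (D := D₁) (by positivity) Δ
    (li.map fun w x => ⌊Real.log (w (φ x)) / η⌋) B ?_ ?_
  · refine hinfcell.mono (by positivity) ?_
    rw [List.length_map]
    have : (1 : ℝ) ≤ (m : ℝ) ^ 2 * Δ.card := one_le_mul_of_one_le_of_one_le (one_le_pow₀ hm1') hΔ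
    rw [show (2 : ℝ) ^ (s + 1) = m by simp [hm]]
    gcongr
  · intro c hc x hx
    obtain ⟨w, -, rfl⟩ := List.mem_map.mp hc
    obtain ⟨i, j, hij, h⟩ := exists_abs_log_abv_sub_le_of_sum_eq_zero w.1 _
      (fun i : Fin (2 ^ s) × Bool => signed_ne_zero (b := i.2) (hφ0 _ (hx.1 i))) (hsol x hx)
    refine ⟨i, j, hij, ?_⟩
    rw [AbsoluteValue.map_signed, AbsoluteValue.map_signed, hcard] at h
    change |Real.log (w (φ (x i))) - Real.log (w (φ (x j)))| ≤ _ at h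
    have h1 : |Real.log (w (φ (x i))) / η - Real.log (w (φ (x j))) / η| ≤ Real.log m / η := by
      rw [← sub_div, abs_div, abs_of_pos hη0]
      gcongr
    have h2 := abs_le.mp h1
    have a1 := Int.floor_le (Real.log (w (φ (x i))) / η)
    have a2 := Int.lt_floor_add_one (Real.log (w (φ (x i))) / η)
    have b1 := Int.floor_le (Real.log (w (φ (x j))) / η)
    have b2 := Int.lt_floor_add_one (Real.log (w (φ (x j))) / η)
    rw [Finset.mem_Icc]
    constructor
    · have : (-(M : ℤ) : ℝ) ≤
        (⌊Real.log (w (φ (x i))) / η⌋ - ⌊Real.log (w (φ (x j))) / η⌋ : ℤ) := by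
        push_cast; linarith
      exact_mod_cast this
    · have : ((⌊Real.log (w (φ (x i))) / η⌋ - ⌊Real.log (w (φ (x j))) / η⌋ : ℤ) : ℝ) ≤ (M : ℤ) := by
        push_cast; linarith
      exact_mod_cast this
  · intro Q hQ hQc
    have hfincell := Dissociated.of_list (s := s) (θ := θ) (D := D₀) (by positivity) {(0 : ℝ)}
      (lf.map fun v x => Real.log (HeightOneSpectrum.adicAbv L v (φ x))) Q ?_ ?_
    · refine hfincell.mono (by positivity) ?_
      rw [List.length_map, Finset.card_singleton, Nat.cast_one, mul_one,
        show (2 : ℝ) ^ (s + 1) = m by simp [hm]]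
      have : (1 : ℝ) ≤ (m : ℝ) ^ 2 := one_le_pow₀ hm1'
      refine mul_le_mul_of_nonneg_right (pow_le_pow_right₀ this hlf) hD₀0
    · intro c hc x hx
      obtain ⟨v, -, rfl⟩ := List.mem_map.mp hc
      obtain ⟨i, j, hij, h⟩ := exists_abv_eq_of_sum_eq_zero (HeightOneSpectrum.adicAbv L v)
        (HeightOneSpectrum.isNonarchimedean_adicAbv L v) _
        (fun i : Fin (2 ^ s) × Bool => signed_ne_zero (b := i.2) (hφ0 _ (hQ (hx.1 i))))
        (hsol x (hx.mono hQ))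
      refine ⟨i, j, hij, ?_⟩
      rw [AbsoluteValue.map_signed, AbsoluteValue.map_signed] at h
      simp [h]
    · intro R hR hRc
      have hRB := hR.trans hQ
      have := hcell θ R φ (hinj.mono (by exact_mod_cast hRB)) (fun x hx => hφ0 x (hRB hx))
        (fun x hx => hsol x (hx.mono hRB)) ?_ ?_
      · rw [hD₀, hm]; push_cast; exact this
      · intro v x hx y hy
        have h := hcf (fun j => q x j - q y j) (fun v hv => by
          rw [hdiff _ x (hRB hx) y (hRB hy), sub_eq_zero]
          exact hRc _ (List.mem_map_of_mem hv) x hx y hy) v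
        rw [hdiff _ x (hRB hx) y (hRB hy), sub_eq_zero] at h
        exact Real.log_injOn_pos (Set.mem_Ioi.mpr (AbsoluteValue.pos _ (hφ0 x (hRB hx))))
          (Set.mem_Ioi.mpr (AbsoluteValue.pos _ (hφ0 y (hRB hy)))) h
      · intro w x hx y hy
        have h := hci (fun j => q x j - q y j) η (fun w hw => by
          have h1 := hdiff w.1 x (hRB hx) y (hRB hy)
          have h2 := hQc _ (List.mem_map_of_mem hw) x (hR hx) y (hR hy)
          have h3 := Int.abs_sub_lt_one_of_floor_eq_floor h2
          rw [← sub_div, abs_div, abs_of_pos hη0, div_lt_one hη0] at h3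
          change |∑ j, Real.log (w.1 (g j)) * _| ≤ _
          rw [h1]
          exact h3.le) hη0.le w
        have h1 := hdiff w.1 x (hRB hx) y (hRB hy)
        change |∑ j, Real.log (w.1 (g j)) * _| ≤ _ at h
        rw [h1, hη, mul_div_cancel₀ _ (by positivity)] at h
        exact (abs_le.mp h).2

end NumberFieldDissociated

section Specialization

lemma numberField_quotient {A : Type*} [CommRing A] [Algebra ℚ A] [Algebra.FiniteType ℚ A]
    (M : Ideal A) [M.IsMaximal] :
    letI := Ideal.Quotient.field M
    NumberField (A ⧸ M) := by
  let := Ideal.Quotient.field M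
  have h3 : Module.Finite ℚ (A ⧸ M) := finite_of_finite_type_of_isJacobsonRing ℚ (A ⧸ M)
  have h4 : CharZero (A ⧸ M) := algebraRat.charZero _
  refine { to_charZero := h4, to_finiteDimensional := ?_ }
  convert h3
  exact Subsingleton.elim _ _

/-- Finitely many nonzero elements of a field of characteristic zero specialize to nonzero
elements of a number field. -/
lemma exists_numberField_specialization {K : Type*} [Field K] [CharZero K] (T : Finset K) :
    ∃ (R : Subalgebra ℚ K) (M : Ideal R) (_ : M.IsMaximal),
      (letI := Ideal.Quotient.field M; NumberField (R ⧸ M)) ∧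
      ∀ t ∈ T, t ≠ 0 → ∃ z : Rˣ, ((z : R) : K) = t := by
  classical
  let U : Finset K := T ∪ T.image fun t => t⁻¹
  let R : Subalgebra ℚ K := Algebra.adjoin ℚ (U : Set K)
  obtain ⟨M, hM⟩ := Ideal.exists_maximal R
  refine ⟨R, M, hM, ?_, ?_⟩
  · have : Algebra.FiniteType ℚ R :=
      (Subalgebra.fg_iff_finiteType R).mp (Subalgebra.fg_adjoin_finset U)
    exact numberField_quotient M
  · intro t ht ht0
    have h1 : t ∈ R := Algebra.subset_adjoin (by simp [U, ht])
    have h2 : t⁻¹ ∈ R := Algebra.subset_adjoin (by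
      simp only [U, Finset.coe_union, Finset.coe_image]
      exact Or.inr ⟨t, ht, rfl⟩)
    exact ⟨⟨⟨t, h1⟩, ⟨t⁻¹, h2⟩, Subtype.ext (mul_inv_cancel₀ ht0),
      Subtype.ext (inv_mul_cancel₀ ht0)⟩, rfl⟩

/-- Finite subsets of a group of finite rank in a field of characteristic zero are dissociated,
with a constant depending only on the rank. -/
lemma Dissociated.of_finRank (s ρ : ℕ) : ∃ D : ℝ, 0 ≤ D ∧
    ∀ {K : Type*} [Field K] [CharZero K] (Γ : Subgroup Kˣ), FinRank Γ ρ → ∀ (B : Finset K),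
      (∀ b ∈ B, ∃ u : Kˣ, u ∈ Γ ∧ (u : K) = b) → ∀ a : K, a ≠ 0 →
      Dissociated s (fun x => a * x) B D := by
  obtain ⟨D, hD, h⟩ := Dissociated.of_numberField s ρ
  refine ⟨D, hD, ?_⟩
  intro K _ _ Γ hΓ B hB a ha
  classical
  obtain ⟨S, hScard, hSΓ, hS⟩ := hΓ
  let T : Finset K := B ∪ S.image (fun u : Kˣ => (u : K)) ∪
    (B ×ˢ B).image fun p => p.1 - p.2
  obtain ⟨R, M, hM, hL, hT⟩ := exists_numberField_specialization T
  let := Ideal.Quotient.field M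
  have : NumberField (R ⧸ M) := hL
  let π : R →+* R ⧸ M := Ideal.Quotient.mk M
  have hB0 : ∀ b ∈ B, b ≠ 0 := by
    intro b hb
    obtain ⟨u, -, rfl⟩ := hB b hb
    exact u.ne_zero
  have hBz : ∀ b ∈ B, ∃ z : Rˣ, ((z : R) : K) = b := fun b hb =>
    hT b (by simp [T, hb]) (hB0 b hb)
  choose! ζ hζ using hBz
  have hSz : ∀ u ∈ S, ∃ z : Rˣ, ((z : R) : K) = u := fun u hu =>
    hT u (by simp only [T, Finset.mem_union]
             exact Or.inl (Or.inr (Finset.mem_image_of_mem _ hu))) u.ne_zero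
  choose! σ hσ using hSz
  let e : S ≃ Fin ρ := S.equivFinOfCardEq hScard
  let g : Fin ρ → R ⧸ M := fun j => π (σ (e.symm j))
  have hπ0 : ∀ z : Rˣ, π z ≠ 0 := fun z => (z.isUnit.map π).ne_zero
  have hclos : ∀ y ∈ Subgroup.closure (S : Set Kˣ), ∃ z : Rˣ, ((z : R) : K) = y ∧
      ∃ q : Fin ρ → ℝ, ∀ v : AbsoluteValue (R ⧸ M) ℝ,
        Real.log (v (π z)) = ∑ j, Real.log (v (g j)) * q j := by
    intro y hy
    induction hy using Subgroup.closure_induction with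
    | mem u hu =>
      refine ⟨σ u, hσ u hu, Pi.single (e ⟨u, hu⟩) 1, fun v => ?_⟩
      simp [g, Pi.single_apply]
    | one => exact ⟨1, by simp, 0, fun v => by simp⟩
    | mul x y _ _ hx hy =>
      obtain ⟨z, hz, q, hq⟩ := hx
      obtain ⟨z', hz', q', hq'⟩ := hy
      refine ⟨z * z', by simp [hz, hz'], q + q', fun v => ?_⟩
      rw [Units.val_mul, map_mul, map_mul, Real.log_mul (v.ne_zero (hπ0 _)) (v.ne_zero (hπ0 _)),
        hq, hq', ← Finset.sum_add_distrib]
      simp [mul_add]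
    | inv x _ hx =>
      obtain ⟨z, hz, q, hq⟩ := hx
      refine ⟨z⁻¹, ?_, -q, fun v => ?_⟩
      · rw [Units.val_inv_eq_inv_val, ← hz]
        refine eq_inv_of_mul_eq_one_left ?_
        exact congr_arg (fun r : R => (r : K)) z.inv_mul
      · have h1 : π ((z⁻¹ : Rˣ) : R) = (π z)⁻¹ := by
          refine eq_inv_of_mul_eq_one_left ?_
          rw [← map_mul, z.inv_mul, map_one]
        rw [h1, map_inv₀, Real.log_inv, hq]
        simp
  have hq : ∀ b ∈ B, ∃ q : Fin ρ → ℝ, ∀ v : AbsoluteValue (R ⧸ M) ℝ,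
      Real.log (v (π (ζ b))) = ∑ j, Real.log (v (g j)) * q j := by
    intro b hb
    obtain ⟨u, hu, hub⟩ := hB b hb
    obtain ⟨k, hk, hmem⟩ := hS u hu
    obtain ⟨z, hz, q, hq⟩ := hclos _ hmem
    refine ⟨fun j => q j / k, fun v => ?_⟩
    have h1 : (ζ b : R) ^ k = z := by
      refine Subtype.ext ?_
      rw [hz, SubmonoidClass.coe_pow, hζ b hb, ← hub]
      simp
    have h2 := hq v
    rw [← h1, map_pow, map_pow, Real.log_pow] at h2
    have hk0 : (k : ℝ) ≠ 0 := by positivity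
    rw [← mul_right_inj' hk0, h2, Finset.mul_sum]
    refine Finset.sum_congr rfl fun j _ => ?_
    field_simp
  choose! q hq using hq
  refine h (fun x => a * x) B (fun x => π (ζ x)) q g ?_ (fun x _ => hπ0 _) ?_ fun v x hx => hq x hx v
  · intro x hx y hy hxy
    by_contra hne
    have hx : x ∈ B := hx
    have hy : y ∈ B := hy
    obtain ⟨z, hz⟩ := hT (x - y) (by
      simp only [T, Finset.mem_union]
      exact Or.inr (Finset.mem_image.mpr ⟨(x, y), by simp [hx, hy], rfl⟩)) (sub_ne_zero.mpr hne)
    have h1 : (z : R) = (ζ x : R) - ζ y := Subtype.ext (by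
      rw [hz, AddSubgroupClass.coe_sub, hζ x hx, hζ y hy])
    refine hπ0 z ?_
    rw [h1, map_sub, sub_eq_zero]
    exact hxy
  · intro x hx
    have h1 : ∑ i, signed i.2 (ζ (x i) : R) = 0 := by
      refine Subtype.ext ?_
      have h2 : a * ∑ i, signed i.2 (x i) = 0 := by
        rw [Finset.mul_sum, ← hx.2]
        exact Finset.sum_congr rfl fun i _ => mul_signed _ _ _
      have h3 := (mul_eq_zero.mp h2).resolve_left ha
      rw [AddSubmonoidClass.coe_finsetSum, ZeroMemClass.coe_zero, ← h3]
      refine Finset.sum_congr rfl fun i _ => ?_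
      rw [show ((signed i.2 (ζ (x i) : R) : R) : K) = R.val (signed i.2 (ζ (x i) : R)) from rfl,
        map_signed]
      congr 1
      exact hζ _ (hx.1 i)
    have h4 := congr_arg π h1
    rw [map_sum, map_zero] at h4
    rw [← h4]
    exact Finset.sum_congr rfl fun i _ => (map_signed π _ _).symm

end Specialization

section WeightedCount

open AddMonoidAlgebra

/-- Weighted count of the solutions of a linear equation in a group of finite rank. -/
lemma exists_weighted_linear_equation_bound (k ρ : ℕ) : ∃ C : ℝ, 0 < C ∧
    ∀ {K ι : Type*} [Field K] [CharZero K] [Fintype ι] [DecidableEq K] [DecidableEq ι]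
      (Γ : Subgroup Kˣ), FinRank Γ ρ → ∀ B : Finset K, (∀ b ∈ B, ∃ u : Kˣ, u ∈ Γ ∧ (u : K) = b) →
      ∀ (a : ι → K) (c : K) (w : ι → K → ℝ), (∀ i, a i ≠ 0) → (∀ i x, 0 ≤ w i x) →
      Fintype.card ι ≤ k →
      ∑ x ∈ Fintype.piFinset fun _ : ι => B,
        (if ∑ i, a i * x i = c then ∏ i, w i (x i) else 0) ≤
      C * ∏ i, √(∑ x ∈ B, w i x ^ 2) := by
  obtain ⟨D, hD, h⟩ := Dissociated.of_finRank k ρ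
  refine ⟨max 1 (√D) ^ k, by positivity, ?_⟩
  intro K ι _ _ _ _ _ Γ hΓ B hB a c w ha hw hcard
  have hk : Fintype.card ι ≤ 2 ^ (k + 1) :=
    hcard.trans ((Nat.lt_two_pow_self).le.trans (Nat.pow_le_pow_right (by norm_num) (by omega)))
  let f : ι ⊕ Fin (2 ^ (k + 1) - Fintype.card ι) → AddMonoidAlgebra ℝ K :=
    Sum.elim (fun i => expSum (fun x => a i * x) B (w i)) fun _ => 1
  have hfprod : ∏ i, f i = ∏ i, ∑ x ∈ B, single (a i * x) (w i x) := by
    simp [f, expSum]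
  have hH := pow_coeff_prod_le k Finset.univ (by simp [hk]) f (single (-c) (1 : ℝ)) (by
    simp [gaStar_single, one_def])
  have hcoeff : (single (-c) (1 : ℝ) * ∏ i, f i).coeff 0 = ∑ x ∈ Fintype.piFinset fun _ : ι => B,
      (if ∑ i, a i * x i = c then ∏ i, w i (x i) else 0) := by
    rw [← coeff_prod_sum_single (fun _ : ι => B) (fun i x => a i * x) w c, ← hfprod, mul_comm,
      coeff_mul_single_eq_coeff_mul c, mul_one]
    intro b _
    rw [add_neg_eq_zero]
  rw [hcoeff] at hH
  have hW : ∀ i, 0 ≤ ∑ x ∈ B, w i x ^ 2 := fun i => Finset.sum_nonneg fun x _ => sq_nonneg _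
  have hmom : ∏ i, moment k (f i) ≤ (∏ i, √(D * ∑ x ∈ B, w i x ^ 2)) ^ 2 ^ (k + 1) := by
    rw [Fintype.prod_sum_type]
    simp only [f, Sum.elim_inl, Sum.elim_inr, moment_one, Finset.prod_const_one, mul_one]
    rw [← Finset.prod_pow]
    refine Finset.prod_le_prod (fun i _ => moment_nonneg _ _) fun i _ => ?_
    rw [pow_succ', pow_mul, Real.sq_sqrt (mul_nonneg hD (hW i))]
    exact h Γ hΓ B hB (a i) (ha i) (w i) (hw i)
  have hle := le_of_pow_le_pow_left₀ (by positivity)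
    (Finset.prod_nonneg fun i _ => Real.sqrt_nonneg _) (hH.trans hmom)
  refine hle.trans ?_
  simp_rw [Real.sqrt_mul hD]
  rw [Finset.prod_mul_distrib, Finset.prod_const, Finset.card_univ]
  have h0 : 0 ≤ ∏ i, √(∑ x ∈ B, w i x ^ 2) := Finset.prod_nonneg fun i _ => Real.sqrt_nonneg _
  gcongr
  calc √D ^ Fintype.card ι ≤ max 1 (√D) ^ Fintype.card ι := by gcongr; exact le_max_right _ _
    _ ≤ max 1 (√D) ^ k := pow_le_pow_right₀ (le_max_left _ _) hcard

end WeightedCount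

section TracePow

open Polynomial

lemma Matrix.det_aeval_eq_of_charpoly_eq {F n : Type*} [Field F] [IsAlgClosed F] [Fintype n]
    [DecidableEq n] {X Y : Matrix n n F} (h : X.charpoly = Y.charpoly) (p : F[X]) :
    (aeval X p).det = (aeval Y p).det := by
  have key : ∀ Z : Matrix n n F, (aeval Z p).det =
      p.leadingCoeff ^ Fintype.card n *
        (p.roots.map fun r => (-1) ^ Fintype.card n * Z.charpoly.eval r).prod := by
    intro Z
    let ψ : F[X] →* F := Matrix.detMonoidHom.comp (MonoidHomClass.toMonoidHom (aeval (R := F) Z))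
    have hψ : ∀ q, ψ q = (aeval Z q).det := fun q => rfl
    rw [← hψ]
    conv_lhs => rw [(IsAlgClosed.splits p).eq_prod_roots]
    rw [map_mul, map_multiset_prod, Multiset.map_map, hψ, aeval_C,
      Matrix.algebraMap_eq_diagonal, Matrix.det_diagonal]
    simp only [Pi.algebraMap_apply, Algebra.algebraMap_self_apply, Finset.prod_const,
      Finset.card_univ]
    congr 2
    refine Multiset.map_congr rfl fun r _ => ?_
    rw [Function.comp_apply, hψ, map_sub, aeval_X, aeval_C, Matrix.eval_charpoly,
      ← Matrix.det_neg, neg_sub]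
    rfl
  rw [key, key, h]

lemma Matrix.charpoly_pow_eq_of_charpoly_eq {F n : Type*} [Field F] [IsAlgClosed F] [Fintype n]
    [DecidableEq n] {X Y : Matrix n n F} (h : X.charpoly = Y.charpoly) (k : ℕ) :
    (X ^ k).charpoly = (Y ^ k).charpoly := by
  refine Polynomial.funext fun c => ?_
  have key : ∀ Z : Matrix n n F, (Z ^ k).charpoly.eval c = (aeval Z (C c - Polynomial.X ^ k)).det := by
    intro Z
    rw [Matrix.eval_charpoly, map_sub, aeval_C, map_pow, aeval_X]
    rfl
  rw [key, key, Matrix.det_aeval_eq_of_charpoly_eq h]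

lemma Matrix.trace_pow_eq_of_charpoly_eq {F n : Type*} [Field F] [Fintype n] [DecidableEq n]
    {X Y : Matrix n n F} (h : X.charpoly = Y.charpoly) (k : ℕ) :
    (X ^ k).trace = (Y ^ k).trace := by
  cases isEmpty_or_nonempty n
  · simp [Matrix.trace]
  let φ := algebraMap F (AlgebraicClosure F)
  have h1 := Matrix.charpoly_pow_eq_of_charpoly_eq (X := X.map φ) (Y := Y.map φ)
    (by rw [Matrix.charpoly_map, Matrix.charpoly_map, h]) k
  have h2 := congr_arg (fun p => -p.coeff (Fintype.card n - 1)) h1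
  simp only [← Matrix.trace_eq_neg_charpoly_coeff] at h2
  have h3 : ∀ Z : Matrix n n F, (Z.map φ ^ k).trace = φ ((Z ^ k).trace) := by
    intro Z
    rw [← Matrix.map_pow]
    exact (AddMonoidHom.map_trace φ.toAddMonoidHom (Z ^ k)).symm
  rw [h3, h3] at h2
  exact φ.injective h2

end TracePow

section SumPairs

/-- Pairs of indices in increasing order with respect to a rank function. -/
abbrev RankPairs {V : Type*} (r : V → ℕ) : Type _ := {p : V × V // r p.1 < r p.2}

lemma sum_sum_eq_sum_diag_add_sum_rankPairs {V M : Type*} [Fintype V] [DecidableEq V]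
    [AddCommMonoid M] {r : V → ℕ} (hr : Function.Injective r) (g : V → V → M) :
    ∑ i, ∑ j, g i j =
      ∑ i, g i i + ∑ p : RankPairs r, (g p.1.1 p.1.2 + g p.1.2 p.1.1) := by
  have h1 : ∀ q : V × V → M, ∑ p : RankPairs r, q p.1 =
      ∑ i, ∑ j, if r i < r j then q (i, j) else 0 := by
    intro q
    rw [← Fintype.sum_prod_type' (f := fun i j => if r i < r j then q (i, j) else 0),
      ← Finset.sum_filter]
    exact (Finset.sum_subtype _ (fun p => by simp) q).symm
  rw [Finset.sum_add_distrib, h1 fun p => g p.1 p.2, h1 fun p => g p.2 p.1,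
    Finset.sum_comm (f := fun i j => if r i < r j then g j i else 0),
    ← Finset.sum_add_distrib, ← Finset.sum_add_distrib]
  refine Finset.sum_congr rfl fun i _ => ?_
  have hi : g i i = ∑ j, if i = j then g i j else 0 := by simp
  rw [hi, ← Finset.sum_add_distrib, ← Finset.sum_add_distrib]
  refine Finset.sum_congr rfl fun j _ => ?_
  rcases lt_trichotomy (r i) (r j) with h | h | h
  · have : i ≠ j := by rintro rfl; exact lt_irrefl _ h
    simp [h, h.le.not_gt, this]
  · simp [hr h]
  · have : i ≠ j := by rintro rfl; exact lt_irrefl _ h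
    simp [h, h.le.not_gt, this]

lemma two_mul_card_rankPairs {V : Type*} [Fintype V] [DecidableEq V] {r : V → ℕ}
    (hr : Function.Injective r) :
    2 * Fintype.card (RankPairs r) + Fintype.card V = Fintype.card V ^ 2 := by
  have h := sum_sum_eq_sum_diag_add_sum_rankPairs hr fun _ _ => 1
  simp at h
  rw [sq, h]
  ring

end SumPairs

section TraceCube

variable {F V : Type*} [Field F] [Fintype V] [DecidableEq V]

/-- The part of the entry `(X * X) e o` that avoids the indices `e` and `o`. -/
def Matrix.offProd (X : Matrix V V F) (e o : V) : F :=
  ∑ k ∈ ({e, o} : Finset V)ᶜ, X e k * X k o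

lemma Matrix.mul_self_apply_eq_offProd_add (X : Matrix V V F) {e o : V} (h : e ≠ o) :
    (X * X) e o = X.offProd e o + (X e e * X e o + X e o * X o o) := by
  rw [Matrix.mul_apply, Matrix.offProd, ← Finset.sum_compl_add_sum {e, o},
    Finset.sum_pair h]

lemma Matrix.mul_offProd_add_mul_offProd_eq_zero [CharZero F] {X Y : Matrix V V F} {e o : V}
    (h : e ≠ o)
    (hXY : ∀ i j, ¬(i = o ∧ j = e) → ¬(i = e ∧ j = o) → Y i j = X i j)
    (hprod : Y o e * Y e o = X o e * X e o) (htr : (Y ^ 3).trace = (X ^ 3).trace) :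
    (Y o e - X o e) * X.offProd e o + (Y e o - X e o) * X.offProd o e = 0 := by
  set α := Y o e - X o e with hα
  set β := Y e o - X e o with hβ
  set E : Matrix V V F := Matrix.single o e α + Matrix.single e o β with hE
  have hY : Y = X + E := by
    ext i j
    by_cases h1 : i = o ∧ j = e
    · obtain ⟨rfl, rfl⟩ := h1
      simp [hE, hα, h]
    by_cases h2 : i = e ∧ j = o
    · obtain ⟨rfl, rfl⟩ := h2
      simp [hE, hβ, h, h.symm]
    rw [hXY i j h1 h2]
    simp [hE, Matrix.single_apply]
    rw [if_neg (by tauto), if_neg (by tauto), add_zero]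
  have hEE : E * E = Matrix.single o o (α * β) + Matrix.single e e (α * β) := by
    simp [hE, add_mul, mul_add, Matrix.single_mul_single_same,
      Matrix.single_mul_single_of_ne, h, h.symm, mul_comm β]
    exact add_comm _ _
  have hcube : (Y ^ 3).trace = (X ^ 3).trace + 3 * (X * X * E).trace + 3 * (X * (E * E)).trace
      + (E * (E * E)).trace := by
    have : Y ^ 3 = X ^ 3 + X * X * E + X * E * X + E * X * X + X * E * E + E * X * E
        + E * E * X + E * (E * E) := by
      rw [hY]; noncomm_ring
    rw [this]
    simp only [Matrix.trace_add]
    have e1 : (X * E * X).trace = (X * X * E).trace := by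
      rw [Matrix.trace_mul_comm, Matrix.mul_assoc]
    have e2 : (E * X * X).trace = (X * X * E).trace := by
      rw [Matrix.mul_assoc, Matrix.trace_mul_comm]
    have e3 : (E * X * E).trace = (X * (E * E)).trace := by
      rw [Matrix.mul_assoc, Matrix.trace_mul_comm, Matrix.mul_assoc]
    have e4 : (E * E * X).trace = (X * (E * E)).trace := Matrix.trace_mul_comm _ _
    rw [e1, e2, e3, e4, Matrix.mul_assoc X E E]
    ring
  have t1 : (X * X * E).trace = α * (X * X) e o + β * (X * X) o e := by
    simp [hE, mul_add, Matrix.trace_mul_single, mul_comm]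
  have t2 : (X * (E * E)).trace = α * β * (X o o + X e e) := by
    rw [hEE]
    simp [mul_add, Matrix.trace_mul_single]
    ring
  have t3 : (E * (E * E)).trace = 0 := by
    rw [hEE]
    simp [mul_add, Matrix.trace_mul_single, hE, h, h.symm]
  rw [hcube, t1, t2, t3, X.mul_self_apply_eq_offProd_add h,
    X.mul_self_apply_eq_offProd_add h.symm] at htr
  have h3 : (3 : F) ≠ 0 := by norm_num
  apply mul_left_cancel₀ h3
  have hp : α * X e o + β * X o e + α * β = 0 := by
    rw [hα, hβ]; linear_combination hprod
  linear_combination htr - 3 * (X e e + X o o) * hp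

/-- Matrices that agree outside two mirror entries, with the product of these entries and the
trace of the cube prescribed, number at most two. -/
lemma card_le_two_of_trace_cube_eq [CharZero F] {e o : V} (h : e ≠ o) {y t : F} (hy : y ≠ 0)
    (S : Finset (Matrix V V F))
    (hS : ∀ X ∈ S, ∀ Y ∈ S, ∀ i j, ¬(i = o ∧ j = e) → ¬(i = e ∧ j = o) → Y i j = X i j)
    (hprod : ∀ X ∈ S, X o e * X e o = y) (htr : ∀ X ∈ S, (X ^ 3).trace = t)
    (hP : ∀ X ∈ S, X.offProd e o ≠ 0) : S.card ≤ 2 := by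
  have hdet : ∀ X ∈ S, ∀ Y ∈ S, X o e = Y o e → X = Y := by
    intro X hX Y hY hXY
    have h1 := hprod X hX
    have h2 := hprod Y hY
    ext i j
    by_cases h3 : i = o ∧ j = e
    · rw [h3.1, h3.2, hXY]
    by_cases h4 : i = e ∧ j = o
    · rw [h4.1, h4.2]
      rw [hXY] at h1
      exact mul_left_cancel₀ (left_ne_zero_of_mul (h2 ▸ hy)) (h1.trans h2.symm)
    exact (hS X hX Y hY i j h3 h4).symm
  have hpair : ∀ X ∈ S, ∀ Y ∈ S, X ≠ Y →
      X o e * Y o e * X.offProd e o = y * X.offProd o e := by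
    intro X hX Y hY hne
    have h0 := Matrix.mul_offProd_add_mul_offProd_eq_zero h (hS X hX Y hY)
      ((hprod Y hY).trans (hprod X hX).symm) ((htr Y hY).trans (htr X hX).symm)
    have h1 := hprod X hX
    have h2 := hprod Y hY
    have hd : Y o e - X o e ≠ 0 := fun hc => hne (hdet X hX Y hY (sub_eq_zero.1 hc).symm)
    apply mul_left_cancel₀ hd
    linear_combination (X o e * Y o e) * h0 - (X.offProd o e * X o e) * h2
      + (X.offProd o e * Y o e) * h1
  by_contra hcon
  obtain ⟨X, Y, Z, hX, hY, hZ, hXY, hXZ, hYZ⟩ := Finset.two_lt_card_iff.1 (not_le.1 hcon)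
  refine hYZ (hdet Y hY Z hZ ?_)
  have h1 := (hpair X hX Y hY hXY).trans (hpair X hX Z hZ hXZ).symm
  have h2 := mul_right_cancel₀ (hP X hX) h1
  exact mul_left_cancel₀ (left_ne_zero_of_mul ((hprod X hX) ▸ hy)) h2

end TraceCube

section Fibres

lemma Finset.card_le_card_mul_of_maps_to {α β : Type*} [DecidableEq β] {f : α → β} {s : Finset α}
    {t : Finset β} {c : ℝ} (hf : ∀ a ∈ s, f a ∈ t)
    (hc : ∀ b ∈ t, ((s.filter fun a => f a = b).card : ℝ) ≤ c) :
    (s.card : ℝ) ≤ t.card * c := by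
  rw [Finset.card_eq_sum_card_fiberwise (f := f) (t := t) hf]
  push_cast
  simpa using Finset.sum_le_card_nsmul t _ c hc

lemma Finset.card_mul_card_le_of_coordinate_determined {ι α : Type*} [Fintype ι] [DecidableEq ι]
    [DecidableEq α] (A : Finset α) (U : Finset (ι → α)) (i₀ : ι) (hU : ∀ u ∈ U, ∀ i, u i ∈ A)
    (hdet : ∀ u ∈ U, ∀ v ∈ U, (∀ i, i ≠ i₀ → u i = v i) → u i₀ = v i₀) :
    U.card * A.card ≤ A.card ^ Fintype.card ι := by
  have hpi : (Fintype.piFinset fun _ : ι => A).card = A.card ^ Fintype.card ι := by simp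
  rw [← hpi, ← Finset.card_product]
  refine Finset.card_le_card_of_injOn (fun q => Function.update q.1 i₀ q.2) ?_ ?_
  · intro q hq
    simp only [Finset.coe_product, Set.mem_prod, Finset.mem_coe] at hq
    simp only [Finset.mem_coe, Fintype.mem_piFinset]
    intro i
    by_cases h : i = i₀
    · subst h; simpa using hq.2
    · simpa [Function.update_of_ne h] using hU _ hq.1 i
  · rintro ⟨u, a⟩ hu ⟨v, b⟩ hv huv
    simp only [Finset.coe_product, Set.mem_prod, Finset.mem_coe] at hu hv
    have h : ∀ i, Function.update u i₀ a i = Function.update v i₀ b i := fun i => congr_fun huv i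
    have hab : a = b := by simpa using h i₀
    have hne : ∀ i, i ≠ i₀ → u i = v i := fun i hi => by
      simpa [Function.update_of_ne hi] using h i
    refine Prod.ext (funext fun i => ?_) hab
    by_cases hi : i = i₀
    · rw [hi]; exact hdet u hu.1 v hv.1 hne
    · exact hne i hi

variable {F V : Type*} [Field F] [DecidableEq F]

/-- The number of ways to write `y` as a product of two elements of `A`. -/
def mulCount (A : Finset F) (y : F) : ℕ :=
  ((A ×ˢ A).filter fun q => q.1 * q.2 = y).card

lemma sum_mulCount_le (A B : Finset F) : ∑ y ∈ B, mulCount A y ≤ A.card ^ 2 := by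
  rw [sq, ← Finset.card_product]
  exact (Finset.sum_card_fiberwise_eq_card_filter (A ×ˢ A) B fun q => q.1 * q.2).trans_le
    (Finset.card_filter_le _ _)

variable [Fintype V] [DecidableEq V]

lemma card_le_two_mul_mulCount [CharZero F] {A : Finset F} (hA : (0 : F) ∉ A) {e e' o : V}
    (heo : e ≠ o) {y y' t : F} (S : Finset (Matrix V V F)) (hent : ∀ X ∈ S, ∀ i j, X i j ∈ A)
    (hS : ∀ X ∈ S, ∀ Y ∈ S, ∀ i j, ¬(i = o ∧ j = e) → ¬(i = e ∧ j = o) →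
      ¬(i = o ∧ j = e') → ¬(i = e' ∧ j = o) → Y i j = X i j)
    (hprod : ∀ X ∈ S, X o e * X e o = y) (hprod' : ∀ X ∈ S, X o e' * X e' o = y')
    (htr : ∀ X ∈ S, (X ^ 3).trace = t) (hP : ∀ X ∈ S, X.offProd e o ≠ 0) :
    S.card ≤ 2 * mulCount A y' := by
  refine Finset.card_le_mul_card_image_of_maps_to (f := fun X => (X o e', X e' o)) ?_ 2 ?_
  · intro X hX
    simp [hent X hX, hprod' X hX]
  · intro b _
    rcases S.eq_empty_or_nonempty with rfl | ⟨X₀, hX₀⟩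
    · simp
    have hy : y ≠ 0 := by
      rw [← hprod X₀ hX₀]
      exact mul_ne_zero (fun h => hA (h ▸ hent X₀ hX₀ _ _)) fun h => hA (h ▸ hent X₀ hX₀ _ _)
    refine card_le_two_of_trace_cube_eq heo hy _ ?_ (t := t) ?_ ?_ ?_
    · intro X hX Y hY i j h1 h2
      obtain ⟨hX, hXb⟩ := Finset.mem_filter.1 hX
      obtain ⟨hY, hYb⟩ := Finset.mem_filter.1 hY
      have hb := Prod.ext_iff.1 (hYb.trans hXb.symm)
      by_cases h3 : i = o ∧ j = e'
      · rw [h3.1, h3.2]; exact hb.1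
      by_cases h4 : i = e' ∧ j = o
      · rw [h4.1, h4.2]; exact hb.2
      exact hS X hX Y hY i j h1 h2 h3 h4
    · exact fun X hX => hprod X (Finset.mem_filter.1 hX).1
    · exact fun X hX => htr X (Finset.mem_filter.1 hX).1
    · exact fun X hX => hP X (Finset.mem_filter.1 hX).1

lemma card_le_two_mul_sqrt_mulCount [CharZero F] {A : Finset F} (hA : (0 : F) ∉ A) {e e' o : V}
    (heo : e ≠ o) (heo' : e' ≠ o) {y y' t : F} (S : Finset (Matrix V V F))
    (hent : ∀ X ∈ S, ∀ i j, X i j ∈ A)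
    (hS : ∀ X ∈ S, ∀ Y ∈ S, ∀ i j, ¬(i = o ∧ j = e) → ¬(i = e ∧ j = o) →
      ¬(i = o ∧ j = e') → ¬(i = e' ∧ j = o) → Y i j = X i j)
    (hprod : ∀ X ∈ S, X o e * X e o = y) (hprod' : ∀ X ∈ S, X o e' * X e' o = y')
    (htr : ∀ X ∈ S, (X ^ 3).trace = t) (hP : ∀ X ∈ S, X.offProd e o ≠ 0)
    (hP' : ∀ X ∈ S, X.offProd e' o ≠ 0) :
    (S.card : ℝ) ≤ 2 * (√(mulCount A y) * √(mulCount A y')) := by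
  have h1 : (S.card : ℝ) ≤ 2 * mulCount A y' := mod_cast
    card_le_two_mul_mulCount hA heo S hent hS hprod hprod' htr hP
  have h2 : (S.card : ℝ) ≤ 2 * mulCount A y := mod_cast
    card_le_two_mul_mulCount hA heo' S hent
      (fun X hX Y hY i j a b c d => hS X hX Y hY i j c d a b) hprod' hprod htr hP'
  rw [← Real.sqrt_mul (Nat.cast_nonneg _)]
  have h3 : (S.card : ℝ) / 2 ≤ √(mulCount A y * mulCount A y') := by
    apply Real.le_sqrt_of_sq_le
    rw [sq]
    exact mul_le_mul (by linarith) (by linarith) (by positivity) (by positivity)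
  linarith

end Fibres

section MatrixCount

lemma Matrix.ext_of_rankPairs {F V : Type*} {r : V → ℕ} (hr : Function.Injective r)
    {X Y : Matrix V V F} (hd : ∀ i, X i i = Y i i) (hu : ∀ p : RankPairs r, X p.1.1 p.1.2 = Y p.1.1 p.1.2)
    (hl : ∀ p : RankPairs r, X p.1.2 p.1.1 = Y p.1.2 p.1.1) : X = Y := by
  ext i j
  rcases lt_trichotomy (r i) (r j) with h | h | h
  · exact hu ⟨(i, j), h⟩
  · rw [hr h]; exact hd j
  · exact hl ⟨(j, i), h⟩

variable {F V : Type*} [Field F] [Fintype V] [DecidableEq V]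

lemma Matrix.sum_rankPairs_eq [CharZero F] {r : V → ℕ} (hr : Function.Injective r)
    (X : Matrix V V F) :
    ∑ p : RankPairs r, X p.1.1 p.1.2 * X p.1.2 p.1.1 =
      ((X ^ 2).trace - ∑ i, X i i ^ 2) / 2 := by
  have h : (X ^ 2).trace = ∑ i, ∑ j, X i j * X j i := by
    simp [Matrix.trace, sq, Matrix.mul_apply]
  rw [h, sum_sum_eq_sum_diag_add_sum_rankPairs hr, eq_div_iff (by norm_num : (2 : F) ≠ 0),
    Finset.sum_mul]
  simp only [sq, add_sub_cancel_left]
  exact Finset.sum_congr rfl fun p _ => by ring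

variable [DecidableEq F]

lemma card_mul_card_le_of_offProd_eq_zero [CharZero F] {r : V → ℕ} (hr : Function.Injective r)
    {A : Finset F} (hA : (0 : F) ∉ A) {C : ℝ} (hC : 0 ≤ C)
    (hD : ∀ t : F, (((Fintype.piFinset fun _ : V => A).filter fun d => ∑ i, d i = t).card : ℝ) ≤
      C * √A.card ^ Fintype.card V)
    (hL : ∀ (a : RankPairs r → F) (c : F), (∀ p, a p ≠ 0) →
      (((Fintype.piFinset fun _ : RankPairs r => A).filter fun x => ∑ p, a p * x p = c).card : ℝ) ≤
      C * √A.card ^ Fintype.card (RankPairs r))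
    {e o k₀ : V} (hk₀ : k₀ ≠ e) (hk₀' : k₀ ≠ o)
    (hlt : ∀ k, k ≠ e → k ≠ o → r e < r k ∧ r k < r o)
    {t s : F} (M : Finset (Matrix V V F)) (hent : ∀ X ∈ M, ∀ i j, X i j ∈ A)
    (ht : ∀ X ∈ M, X.trace = t) (hs : ∀ X ∈ M, (X ^ 2).trace = s)
    (hP : ∀ X ∈ M, X.offProd e o = 0) :
    (M.card : ℝ) * A.card ≤ C ^ 2 * A.card ^ Fintype.card (RankPairs r) *
      √A.card ^ (Fintype.card V + Fintype.card (RankPairs r)) := by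
  let u : Matrix V V F → RankPairs r → F := fun X p => X p.1.1 p.1.2
  let l : Matrix V V F → RankPairs r → F := fun X p => X p.1.2 p.1.1
  let δ : Matrix V V F → V → F := fun X i => X i i
  set D := (Fintype.piFinset fun _ : V => A).filter fun d => ∑ i, d i = t with hDdef
  set U := M.image u with hU
  have hne : ∀ X ∈ M, ∀ i j, X i j ≠ 0 := fun X hX i j h => hA (h ▸ hent X hX i j)
  have hM : (M.card : ℝ) ≤ (D ×ˢ U).card * (C * √A.card ^ Fintype.card (RankPairs r)) := by
    refine Finset.card_le_card_mul_of_maps_to (f := fun X => (δ X, u X)) ?_ ?_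
    · intro X hX
      rw [Finset.mem_product]
      refine ⟨Finset.mem_filter.2 ⟨?_, ht X hX⟩, Finset.mem_image_of_mem _ hX⟩
      simp [δ, hent X hX]
    · rintro ⟨d, v⟩ hb
      obtain ⟨-, hv⟩ := Finset.mem_product.1 hb
      obtain ⟨X₀, hX₀, rfl⟩ := Finset.mem_image.1 hv
      refine le_trans ?_ (hL (u X₀) ((s - ∑ i, d i ^ 2) / 2) fun p => hne X₀ hX₀ _ _)
      refine mod_cast Finset.card_le_card_of_injOn l ?_ ?_
      · intro X hX
        simp only [Finset.coe_filter, Set.mem_ofPred_eq, Prod.mk.injEq] at hX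
        obtain ⟨hX, hδ, hu⟩ := hX
        simp only [Finset.coe_filter, Set.mem_ofPred_eq, Fintype.mem_piFinset]
        refine ⟨fun p => hent X hX _ _, ?_⟩
        rw [← hu, ← hδ, ← hs X hX]
        exact X.sum_rankPairs_eq hr
      · intro X hX Y hY hXY
        simp only [Finset.coe_filter, Set.mem_ofPred_eq, Prod.mk.injEq] at hX hY
        exact Matrix.ext_of_rankPairs hr (fun i => congr_fun (hX.2.1.trans hY.2.1.symm) i)
          (fun p => congr_fun (hX.2.2.trans hY.2.2.symm) p) fun p => congr_fun hXY p
  have hUcard : (U.card : ℝ) * A.card ≤ A.card ^ Fintype.card (RankPairs r) := by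
    have h0 := hlt k₀ hk₀ hk₀'
    refine mod_cast Finset.card_mul_card_le_of_coordinate_determined A U ⟨(k₀, o), h0.2⟩ ?_ ?_
    · intro v hv p
      obtain ⟨X, hX, rfl⟩ := Finset.mem_image.1 hv
      exact hent X hX _ _
    · intro v hv v' hv' hvv
      obtain ⟨X, hX, rfl⟩ := Finset.mem_image.1 hv
      obtain ⟨Y, hY, rfl⟩ := Finset.mem_image.1 hv'
      have hagree : ∀ i j, r i < r j → ¬(i = k₀ ∧ j = o) → X i j = Y i j := by
        intro i j hij hn
        exact hvv ⟨(i, j), hij⟩ fun h => hn (by simpa using h)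
      have hmem : k₀ ∈ ({e, o} : Finset V)ᶜ := by simp [hk₀, hk₀']
      have hX0 := hP X hX
      have hY0 := hP Y hY
      rw [Matrix.offProd, ← Finset.add_sum_erase _ _ hmem] at hX0 hY0
      have hsum : ∑ k ∈ ({e, o} : Finset V)ᶜ.erase k₀, X e k * X k o =
          ∑ k ∈ ({e, o} : Finset V)ᶜ.erase k₀, Y e k * Y k o := by
        refine Finset.sum_congr rfl fun k hk => ?_
        simp only [Finset.mem_erase, Finset.mem_compl, Finset.mem_insert, Finset.mem_singleton,
          not_or] at hk
        obtain ⟨hk1, hk2, hk3⟩ := hk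
        rw [hagree e k (hlt k hk2 hk3).1 fun h => hk3 h.2,
          hagree k o (hlt k hk2 hk3).2 fun h => hk1 h.1]
      have he : X e k₀ = Y e k₀ := hagree e k₀ h0.1 fun h => hk₀' h.2
      rw [hsum, he] at hX0
      exact mul_left_cancel₀ (hne Y hY e k₀) (add_right_cancel (hX0.trans hY0.symm))
  calc (M.card : ℝ) * A.card
      ≤ (D ×ˢ U).card * (C * √A.card ^ Fintype.card (RankPairs r)) * A.card := by gcongr
    _ = D.card * (U.card * A.card) * (C * √A.card ^ Fintype.card (RankPairs r)) := by
        rw [Finset.card_product]; push_cast; ring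
    _ ≤ (C * √A.card ^ Fintype.card V) * A.card ^ Fintype.card (RankPairs r) *
          (C * √A.card ^ Fintype.card (RankPairs r)) := by
        gcongr
        exact hD t
    _ = _ := by ring

end MatrixCount

section NondegenerateCount

variable {F V : Type*} [Field F] [Fintype V] [DecidableEq V] [DecidableEq F]

set_option maxHeartbeats 800000 in
lemma card_mul_card_le_of_offProd_ne_zero [CharZero F] {r : V → ℕ} (hr : Function.Injective r)
    {A : Finset F} (hA : (0 : F) ∉ A) {C : ℝ} (hC : 0 ≤ C)
    (hD : ∀ t : F, (((Fintype.piFinset fun _ : V => A).filter fun d => ∑ i, d i = t).card : ℝ) ≤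
      C * √A.card ^ Fintype.card V)
    (hL : ∀ (a : RankPairs r → F) (c : F) (w : RankPairs r → F → ℝ), (∀ p, a p ≠ 0) →
      (∀ p x, 0 ≤ w p x) →
      ∑ x ∈ Fintype.piFinset fun _ : RankPairs r => A ∪ Finset.image₂ (· * ·) A A,
        (if ∑ p, a p * x p = c then ∏ p, w p (x p) else 0) ≤
      C * ∏ p, √(∑ x ∈ A ∪ Finset.image₂ (· * ·) A A, w p x ^ 2))
    {e e' o : V} (hee' : e ≠ e') (heo : r e < r o) (heo' : r e' < r o)
    {t s s₃ : F} (M : Finset (Matrix V V F)) (hent : ∀ X ∈ M, ∀ i j, X i j ∈ A)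
    (ht : ∀ X ∈ M, X.trace = t) (hs : ∀ X ∈ M, (X ^ 2).trace = s)
    (hs₃ : ∀ X ∈ M, (X ^ 3).trace = s₃)
    (hP : ∀ X ∈ M, X.offProd e o ≠ 0) (hP' : ∀ X ∈ M, X.offProd e' o ≠ 0) :
    (M.card : ℝ) * A.card ≤ 2 * C ^ 2 * A.card ^ Fintype.card (RankPairs r) *
      √A.card ^ (Fintype.card V + Fintype.card (RankPairs r)) := by
  set B := A ∪ Finset.image₂ (· * ·) A A with hB
  let p₀ : RankPairs r := ⟨(e, o), heo⟩
  let p₁ : RankPairs r := ⟨(e', o), heo'⟩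
  have hp : p₀ ≠ p₁ := fun h => hee' (by simpa [p₀, p₁] using h)
  let special : RankPairs r → Prop := fun p => p = p₀ ∨ p = p₁
  let δ : Matrix V V F → V → F := fun X i => X i i
  let l : Matrix V V F → RankPairs r → F := fun X p => if special p then 1 else X p.1.2 p.1.1
  let v : Matrix V V F → RankPairs r → F := fun X p =>
    if special p then X p.1.2 p.1.1 * X p.1.1 p.1.2 else X p.1.1 p.1.2
  let w : RankPairs r → F → ℝ := fun p x =>
    if special p then √(mulCount A x) else if x ∈ A then 1 else 0
  have hw : ∀ p x, 0 ≤ w p x := by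
    intro p x
    dsimp only [w]
    split_ifs <;> positivity
  set D := (Fintype.piFinset fun _ : V => A).filter fun d => ∑ i, d i = t with hDdef
  set Λ := Fintype.piFinset fun p : RankPairs r => if special p then {(1 : F)} else A with hΛ
  have hlv : ∀ (X : Matrix V V F) (p : RankPairs r),
      l X p * v X p = X p.1.1 p.1.2 * X p.1.2 p.1.1 := by
    intro X p
    dsimp only [l, v]
    split_ifs <;> ring
  -- The matrices with prescribed diagonal, lower part and upper part.
  have hfib : ∀ (d : V → F) (y z : RankPairs r → F),
      ((M.filter fun X => (δ X = d ∧ l X = y) ∧ v X = z).card : ℝ) ≤ 2 * ∏ p, w p (z p) := by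
    intro d y z
    set S := M.filter fun X => (δ X = d ∧ l X = y) ∧ v X = z with hS
    rcases S.eq_empty_or_nonempty with h0 | ⟨X₀, hX₀⟩
    · rw [h0]
      simpa using Finset.prod_nonneg fun p _ => hw p (z p)
    have hmem : ∀ X ∈ S, X ∈ M ∧ (δ X = d ∧ l X = y) ∧ v X = z :=
      fun X hX => Finset.mem_filter.1 hX
    have hprod : ∏ p, w p (z p) = √(mulCount A (z p₀)) * √(mulCount A (z p₁)) := by
      rw [Fintype.prod_eq_mul p₀ p₁ hp]
      · simp [w, special]
      · rintro p ⟨h1, h2⟩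
        obtain ⟨hM, -, hv⟩ := hmem X₀ hX₀
        rw [← hv]
        simp [w, v, special, h1, h2, hent X₀ hM]
    rw [hprod]
    have hval : ∀ X ∈ S, X o e * X e o = z p₀ ∧ X o e' * X e' o = z p₁ := by
      intro X hX
      rw [← (hmem X hX).2.2]
      simp [v, special, p₀, p₁]
    refine card_le_two_mul_sqrt_mulCount hA (fun h => heo.ne (congr_arg r h))
      (fun h => heo'.ne (congr_arg r h)) S (fun X hX => hent X (hmem X hX).1) ?_
      (fun X hX => (hval X hX).1)
      (fun X hX => (hval X hX).2) (fun X hX => hs₃ X (hmem X hX).1)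
      (fun X hX => hP X (hmem X hX).1) fun X hX => hP' X (hmem X hX).1
    intro X hX Y hY i j h1 h2 h3 h4
    obtain ⟨-, ⟨hδX, hlX⟩, hvX⟩ := hmem X hX
    obtain ⟨-, ⟨hδY, hlY⟩, hvY⟩ := hmem Y hY
    rcases lt_trichotomy (r i) (r j) with h | h | h
    · have := congr_fun (hvY.trans hvX.symm) ⟨(i, j), h⟩
      simpa [v, special, p₀, p₁, h2, h4] using this
    · rw [hr h]
      exact congr_fun (hδY.trans hδX.symm) j
    · have := congr_fun (hlY.trans hlX.symm) ⟨(j, i), h⟩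
      have h1' : ¬(j = e ∧ i = o) := fun h => h1 h.symm
      have h3' : ¬(j = e' ∧ i = o) := fun h => h3 h.symm
      simpa [l, special, p₀, p₁, h1', h3'] using this
  have hfib' : ∀ b ∈ D ×ˢ Λ, ((M.filter fun X => (δ X, l X) = b).card : ℝ) ≤
      2 * (C * ∏ p, √(∑ x ∈ B, w p x ^ 2)) := by
    rintro ⟨d, y⟩ hb
    obtain ⟨-, hy⟩ := Finset.mem_product.1 hb
    have hy0 : ∀ p, y p ≠ 0 := by
      intro p hp0
      have := Fintype.mem_piFinset.1 hy p
      by_cases h : special p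
      · simp [h, hp0] at this
      · rw [if_neg h] at this
        exact hA (hp0 ▸ this)
    set S := M.filter fun X => (δ X, l X) = (d, y) with hS
    have hSv : ∀ X ∈ S, v X ∈ Fintype.piFinset fun _ : RankPairs r => B := by
      intro X hX
      have hX := (Finset.mem_filter.1 hX).1
      refine Fintype.mem_piFinset.2 fun p => ?_
      dsimp only [v]
      split_ifs
      · exact Finset.mem_union_right _ (Finset.mem_image₂_of_mem (hent X hX _ _) (hent X hX _ _))
      · exact Finset.mem_union_left _ (hent X hX _ _)
    have hsum : ∀ X ∈ S, ∑ p, y p * v X p = (s - ∑ i, d i ^ 2) / 2 := by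
      intro X hX
      obtain ⟨hX, hX'⟩ := Finset.mem_filter.1 hX
      obtain ⟨h1, h2⟩ := Prod.mk.inj hX'
      rw [← h1, ← h2, ← hs X hX]
      exact (Finset.sum_congr rfl fun p _ => hlv X p).trans (X.sum_rankPairs_eq hr)
    calc (S.card : ℝ)
        = ∑ z ∈ Fintype.piFinset fun _ : RankPairs r => B,
            ((S.filter fun X => v X = z).card : ℝ) := by
          rw [Finset.card_eq_sum_card_fiberwise (f := v) hSv]
          push_cast
          rfl
      _ ≤ ∑ z ∈ Fintype.piFinset fun _ : RankPairs r => B,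
            2 * (if ∑ p, y p * z p = (s - ∑ i, d i ^ 2) / 2 then ∏ p, w p (z p) else 0) := by
          refine Finset.sum_le_sum fun z _ => ?_
          split_ifs with hz
          · refine le_trans (le_of_eq ?_) (hfib d y z)
            rw [hS, Finset.filter_filter]
            simp only [Prod.mk.injEq]
          · rw [Finset.filter_eq_empty_iff.2]
            · simp
            · rintro X hX rfl
              exact hz (hsum X hX)
      _ ≤ _ := by
          rw [← Finset.mul_sum]
          exact mul_le_mul_of_nonneg_left (hL y _ w hy0 hw) zero_le_two
  have hM : (M.card : ℝ) ≤ (D ×ˢ Λ).card * (2 * (C * ∏ p, √(∑ x ∈ B, w p x ^ 2))) := by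
    refine Finset.card_le_card_mul_of_maps_to (f := fun X => (δ X, l X)) ?_ hfib'
    intro X hX
    rw [Finset.mem_product]
    refine ⟨Finset.mem_filter.2 ⟨?_, ht X hX⟩, Fintype.mem_piFinset.2 fun p => ?_⟩
    · simp [δ, hent X hX]
    · dsimp only [l]
      split_ifs
      · simp
      · exact hent X hX _ _
  set a : ℝ := (A.card : ℝ) with ha
  have hΛcard : (Λ.card : ℝ) = ∏ p : RankPairs r, if special p then 1 else a := by
    rw [hΛ, Fintype.card_piFinset]
    push_cast
    refine Finset.prod_congr rfl fun p _ => ?_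
    split_ifs <;> simp [ha]
  have hweight : ∏ p, √(∑ x ∈ B, w p x ^ 2) ≤ ∏ p : RankPairs r, if special p then a else √a := by
    refine Finset.prod_le_prod (fun p _ => Real.sqrt_nonneg _) fun p _ => ?_
    split_ifs with h
    · rw [Real.sqrt_le_left (by positivity)]
      simp only [w, if_pos h, Real.sq_sqrt (Nat.cast_nonneg _)]
      rw [ha]
      exact_mod_cast sum_mulCount_le A B
    · refine Real.sqrt_le_sqrt ?_
      simp only [w, if_neg h]
      have : ∀ x, (if x ∈ A then (1 : ℝ) else 0) ^ 2 = if x ∈ A then 1 else 0 := by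
        intro x; split_ifs <;> simp
      simp only [this, Finset.sum_boole]
      rw [ha]
      exact_mod_cast Finset.card_le_card fun x hx => (Finset.mem_filter.1 hx).2
  have hcomb : (∏ p : RankPairs r, if special p then 1 else a) *
      (∏ p : RankPairs r, if special p then a else √a) * a =
      a ^ Fintype.card (RankPairs r) * √a ^ Fintype.card (RankPairs r) := by
    have ha0 : √a * √a = a := Real.mul_self_sqrt (Nat.cast_nonneg _)
    have h1 : (∏ p : RankPairs r, if special p then √a else 1) = a := by
      rw [Fintype.prod_eq_mul p₀ p₁ hp]
      · simp [special, ha0]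
      · rintro p ⟨h1, h2⟩
        simp [special, h1, h2]
    rw [← mul_pow, ← Finset.card_univ, ← Finset.prod_const]
    trans (∏ p : RankPairs r, if special p then 1 else a) *
      (∏ p : RankPairs r, if special p then a else √a) *
      ∏ p : RankPairs r, if special p then √a else 1
    · rw [h1]
    rw [← Finset.prod_mul_distrib, ← Finset.prod_mul_distrib]
    refine Finset.prod_congr rfl fun p _ => ?_
    split_ifs <;> ring
  calc (M.card : ℝ) * a
      ≤ (D ×ˢ Λ).card * (2 * (C * ∏ p, √(∑ x ∈ B, w p x ^ 2))) * a := by gcongr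
    _ = 2 * C * D.card * (Λ.card * (∏ p, √(∑ x ∈ B, w p x ^ 2)) * a) := by
        rw [Finset.card_product]; push_cast; ring
    _ ≤ 2 * C * (C * √a ^ Fintype.card V) *
          (a ^ Fintype.card (RankPairs r) * √a ^ Fintype.card (RankPairs r)) := by
        rw [← hcomb, hΛcard]
        have h0 : (0 : ℝ) ≤ ∏ p : RankPairs r, if special p then 1 else a :=
          hΛcard ▸ Nat.cast_nonneg _
        have h1 := hD t
        gcongr
    _ = _ := by ring

end NondegenerateCount

section Assembly

lemma card_filter_le_of_weighted_linear_equation_bound {F ι : Type*} [Field F] [Fintype ι]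
    [DecidableEq F] [DecidableEq ι] {A : Finset F} {a : ι → F} {c : F} {C : ℝ}
    (h : ∀ w : ι → F → ℝ, (∀ i x, 0 ≤ w i x) →
      ∑ x ∈ Fintype.piFinset fun _ : ι => A, (if ∑ i, a i * x i = c then ∏ i, w i (x i) else 0) ≤
        C * ∏ i, √(∑ x ∈ A, w i x ^ 2)) :
    (((Fintype.piFinset fun _ : ι => A).filter fun x => ∑ i, a i * x i = c).card : ℝ) ≤
      C * √A.card ^ Fintype.card ι := by
  have := h (fun _ _ => 1) fun _ _ => zero_le_one
  simpa using this

lemma three_mul_add_le_two_mul_alphaExp_add_two {n N : ℕ} (h : 2 * N + n = n ^ 2) :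
    3 * N + n ≤ 2 * alphaExp n + 2 := by
  have h1 : n * (n - 1) = 2 * N := by
    rw [Nat.mul_sub_one, ← sq]; omega
  rw [alphaExp, h1]
  omega

lemma le_mul_pow_alphaExp {n N : ℕ} (h : 2 * N + n = n ^ 2) {a x C : ℝ} (ha : 1 ≤ a) (hC : 0 ≤ C)
    (hx : x * a ≤ C * a ^ N * √a ^ (n + N)) : x ≤ C * a ^ alphaExp n := by
  have ha0 : 0 < a := zero_lt_one.trans_le ha
  have hs : √a ^ 2 = a := Real.sq_sqrt ha0.le
  have h1 : 1 ≤ √a := Real.one_le_sqrt.2 ha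
  refine le_of_mul_le_mul_right (hx.trans ?_) ha0
  calc C * a ^ N * √a ^ (n + N) = C * √a ^ (3 * N + n) := by
        conv_lhs => enter [1, 2, 1]; rw [← hs]
        ring
    _ ≤ C * √a ^ (2 * alphaExp n + 2) := by
        exact mul_le_mul_of_nonneg_left
          (pow_le_pow_right₀ h1 (three_mul_add_le_two_mul_alphaExp_add_two h)) hC
    _ = C * a ^ alphaExp n * a := by
        rw [pow_add, pow_mul, hs, mul_assoc]

end Assembly

theorem count_matrices_charpoly (n ρ : ℕ) (hn : 3 ≤ n) :
    ∃ C : ℝ, 0 < C ∧ ∀ (K : Type*) [Field K] [CharZero K] (Γ : Subgroup Kˣ),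
      FinRank Γ ρ →
      ∀ f : Polynomial K, f.Monic → f.natDegree = n →
      ∀ A : Finset K, (∀ a ∈ A, ∃ u : Kˣ, u ∈ Γ ∧ (u : K) = a) →
      ({X : Matrix (Fin n) (Fin n) K | (∀ i j, X i j ∈ A) ∧ X.charpoly = f}.ncard : ℝ) ≤
        C * (A.card : ℝ) ^ alphaExp n := by
  obtain ⟨C, hC, hmain⟩ := exists_weighted_linear_equation_bound (n ^ 2) ρ
  refine ⟨4 * C ^ 2, by positivity, ?_⟩
  intro K _ _ Γ hΓ f _ _ A hAΓ
  classical
  have hA : (0 : K) ∉ A := fun h => by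
    obtain ⟨u, -, hu⟩ := hAΓ 0 h
    exact u.ne_zero hu
  rcases Set.eq_empty_or_nonempty
    {X : Matrix (Fin n) (Fin n) K | (∀ i j, X i j ∈ A) ∧ X.charpoly = f} with h0 | ⟨X₀, hX₀⟩
  · rw [h0, Set.ncard_empty]
    push_cast
    positivity
  let M : Finset (Matrix (Fin n) (Fin n) K) :=
    (Fintype.piFinset fun _ => Fintype.piFinset fun _ => A).filter fun X =>
      Matrix.charpoly X = f
  have hM : ∀ X : Matrix (Fin n) (Fin n) K, X ∈ M ↔ (∀ i j, X i j ∈ A) ∧ X.charpoly = f := by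
    intro X
    refine Finset.mem_filter.trans (and_congr_left' ?_)
    exact Fintype.mem_piFinset.trans (forall_congr' fun _ => Fintype.mem_piFinset)
  have hcard : {X : Matrix (Fin n) (Fin n) K | (∀ i j, X i j ∈ A) ∧ X.charpoly = f}.ncard =
      M.card := by
    rw [← Set.ncard_coe_finset]
    congr 1
    ext X
    exact (hM X).symm
  rw [hcard]
  have ha : (1 : ℝ) ≤ A.card := by
    exact mod_cast Finset.card_pos.2 ⟨_, hX₀.1 ⟨0, by omega⟩ ⟨0, by omega⟩⟩
  have htr : ∀ X ∈ M, ∀ k : ℕ, (X ^ k).trace = (X₀ ^ k).trace := fun X hX k =>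
    Matrix.trace_pow_eq_of_charpoly_eq (((hM X).1 hX).2.trans hX₀.2.symm) k
  have htr1 : ∀ X ∈ M, X.trace = X₀.trace := fun X hX => by simpa using htr X hX 1
  have hB : ∀ b ∈ A ∪ Finset.image₂ (· * ·) A A, ∃ u : Kˣ, u ∈ Γ ∧ (u : K) = b := by
    intro b hb
    rcases Finset.mem_union.1 hb with hb | hb
    · exact hAΓ b hb
    · obtain ⟨x, hx, y, hy, rfl⟩ := Finset.mem_image₂.1 hb
      obtain ⟨u, hu, rfl⟩ := hAΓ x hx
      obtain ⟨v, hv, rfl⟩ := hAΓ y hy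
      exact ⟨u * v, Γ.mul_mem hu hv, by simp⟩
  have hpairs : ∀ r : Fin n → ℕ, Function.Injective r →
      2 * Fintype.card (RankPairs r) + n = n ^ 2 := fun r hr => by
    simpa using two_mul_card_rankPairs hr
  have hcardV : Fintype.card (Fin n) ≤ n ^ 2 := by
    rw [Fintype.card_fin]; exact Nat.le_self_pow two_ne_zero n
  have hD : ∀ t : K, (((Fintype.piFinset fun _ : Fin n => A).filter
      fun d => ∑ i, d i = t).card : ℝ) ≤ C * √A.card ^ Fintype.card (Fin n) := by
    intro t
    simpa using card_filter_le_of_weighted_linear_equation_bound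
      (a := fun _ : Fin n => (1 : K)) (c := t) fun w hw =>
        hmain Γ hΓ A hAΓ _ t w (fun _ => one_ne_zero) hw hcardV
  have hdegenerate : ∀ (r : Fin n → ℕ) (e o k₀ : Fin n), Function.Injective r → (∀ k, r k < n) →
      r e = 0 → r o = n - 1 → k₀ ≠ e → k₀ ≠ o →
      ((M.filter fun X => X.offProd e o = 0).card : ℝ) ≤ C ^ 2 * A.card ^ alphaExp n := by
    intro r e o k₀ hr hrn he ho hk hk'
    have hN := hpairs r hr
    refine le_mul_pow_alphaExp hN ha (sq_nonneg C) ?_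
    have := card_mul_card_le_of_offProd_eq_zero hr hA hC.le hD
      (fun a c h => card_filter_le_of_weighted_linear_equation_bound fun w hw =>
        hmain Γ hΓ A hAΓ a c w h hw (by omega)) hk hk'
      (fun k h1 h2 => by
        have h3 : r k ≠ r e := fun h => h1 (hr h)
        have h4 : r k ≠ r o := fun h => h2 (hr h)
        have := hrn k
        omega)
      (M.filter fun X => X.offProd e o = 0)
      (fun X hX => ((hM X).1 (Finset.mem_filter.1 hX).1).1)
      (fun X hX => htr1 X (Finset.mem_filter.1 hX).1)
      (fun X hX => htr X (Finset.mem_filter.1 hX).1 2)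
      fun X hX => (Finset.mem_filter.1 hX).2
    rwa [Fintype.card_fin] at this
  let e₀ : Fin n := ⟨0, by omega⟩
  let e₁ : Fin n := ⟨1, by omega⟩
  let o : Fin n := ⟨n - 1, by omega⟩
  have h01 : e₀ ≠ e₁ := by simp [e₀, e₁]
  have h0o : e₀ ≠ o := by simp [e₀, o]; omega
  have h1o : e₁ ≠ o := by simp [e₁, o]; omega
  have hM₀ := hdegenerate Fin.val e₀ o e₁ Fin.val_injective Fin.is_lt rfl rfl h01.symm h1o
  have hM₁ := hdegenerate (fun k => (Equiv.swap e₀ e₁ k).val) e₁ o e₀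
    (Fin.val_injective.comp (Equiv.injective _)) (fun k => (Equiv.swap e₀ e₁ k).is_lt)
    (by simp [e₀]) (by simp only [Equiv.swap_apply_of_ne_of_ne h0o.symm h1o.symm, o]) h01 h0o
  have hM₂ : ((M.filter fun X => X.offProd e₀ o ≠ 0 ∧ X.offProd e₁ o ≠ 0).card : ℝ) ≤
      2 * C ^ 2 * A.card ^ alphaExp n := by
    have hN := hpairs Fin.val Fin.val_injective
    refine le_mul_pow_alphaExp hN ha (by positivity) ?_
    have := card_mul_card_le_of_offProd_ne_zero Fin.val_injective hA hC.le hD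
      (fun a c w h hw => hmain Γ hΓ _ hB a c w h hw (by omega)) h01
      (show e₀.val < o.val by simp only [e₀, o]; omega)
      (show e₁.val < o.val by simp only [e₁, o]; omega)
      (M.filter fun X => X.offProd e₀ o ≠ 0 ∧ X.offProd e₁ o ≠ 0)
      (fun X hX => ((hM X).1 (Finset.mem_filter.1 hX).1).1)
      (fun X hX => htr1 X (Finset.mem_filter.1 hX).1)
      (fun X hX => htr X (Finset.mem_filter.1 hX).1 2)
      (fun X hX => htr X (Finset.mem_filter.1 hX).1 3)
      (fun X hX => (Finset.mem_filter.1 hX).2.1)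
      fun X hX => (Finset.mem_filter.1 hX).2.2
    rwa [Fintype.card_fin] at this
  have hsplit : M.card ≤ (M.filter fun X => X.offProd e₀ o = 0).card +
      (M.filter fun X => X.offProd e₁ o = 0).card +
      (M.filter fun X => X.offProd e₀ o ≠ 0 ∧ X.offProd e₁ o ≠ 0).card := by
    refine (Finset.card_le_card fun X hX => ?_).trans
      ((Finset.card_union_le _ _).trans (Nat.add_le_add_right (Finset.card_union_le _ _) _))
    simp only [Finset.mem_union, Finset.mem_filter, hX, true_and]
    tauto
  have hsplit' : (M.card : ℝ) ≤ (M.filter fun X => X.offProd e₀ o = 0).card +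
      (M.filter fun X => X.offProd e₁ o = 0).card +
      (M.filter fun X => X.offProd e₀ o ≠ 0 ∧ X.offProd e₁ o ≠ 0).card := mod_cast hsplit
  linarith
end
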